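/- arXiv:0903.2232 — 10 statements merged into one kernel-verified Lean document; each statement's English description precedes it below -/
import Mathlib

section
/- Let j ≥ 2 be a real number and let λ : [0,1] → [0,1] be a continuous nondecreasing function with λ(0) = 0. Suppose ᾱ > 0 satisfies λ(1 − exp(−ᾱ·j·x)) ≤ x for all x ∈ (0,1], and let α be a real number with 0 < α < ᾱ. For each integer k with k − 1 ≥ ᾱ·j define f_k : [0,1] → [0,1] by f_k(y) = (α/ᾱ)·λ(1 − (1 − ᾱ·j·y/(k−1))^{k−1}). Then there exists K < ∞ such that for every integer k ≥ K, the sequence defined by y_0 = 1 and y_{i+1} = f_k(y_i) converges to 0 as i → ∞. -/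
open Filter

theorem Real.exp_neg_mul_le_one_sub_pow {u r : ℝ} (hu : 0 ≤ u) (hu1 : u < 1)
    (hr : 1 ≤ r * (1 - u)) (n : ℕ) : Real.exp (-(n * u * r)) ≤ (1 - u) ^ n := by
  have h1u : 0 < 1 - u := by linarith
  have hexp : Real.exp (-(u * r)) ≤ 1 - u := by
    rw [Real.exp_neg]
    refine inv_le_of_inv_le₀ h1u ?_
    have h2 : (1 - u)⁻¹ ≤ u * r + 1 := by
      rw [inv_le_iff_one_le_mul₀ h1u]
      nlinarith
    exact h2.trans (Real.add_one_le_exp _)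
  calc Real.exp (-(n * u * r)) = Real.exp (-(u * r)) ^ n := by
        rw [← Real.exp_nat_mul]; congr 1; ring
    _ ≤ (1 - u) ^ n := pow_le_pow_left₀ (Real.exp_pos _).le hexp n

theorem tendsto_iterate_zero_of_le_mul {f : ℝ → ℝ} {q : ℝ} (hq0 : 0 ≤ q) (hq1 : q < 1)
    (hf : ∀ y ∈ Set.Icc (0 : ℝ) 1, 0 ≤ f y ∧ f y ≤ q * y) {y₀ : ℝ}
    (hy₀ : y₀ ∈ Set.Icc (0 : ℝ) 1) :
    Tendsto (fun i : ℕ => f^[i] y₀) atTop (nhds 0) := by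
  have key : ∀ i : ℕ, 0 ≤ f^[i] y₀ ∧ f^[i] y₀ ≤ q ^ i := by
    intro i
    induction i with
    | zero => simpa using hy₀
    | succ i ih =>
      rw [Function.iterate_succ_apply', pow_succ']
      obtain ⟨h1, h2⟩ := hf _ ⟨ih.1, ih.2.trans (pow_le_one₀ hq0 hq1.le)⟩
      exact ⟨h1, h2.trans (mul_le_mul_of_nonneg_left ih.2 hq0)⟩
  exact squeeze_zero (fun i => (key i).1) (fun i => (key i).2)
    (tendsto_pow_atTop_nhds_zero_of_lt_one hq0 hq1)

/-- If `lam (1 - exp (-c x)) ≤ x` on `(0, 1]`, the finite-degree version of the map is bounded by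
`r * y`, where `r` controls the error of `1 - u ≈ exp (-u)`. -/
theorem lam_one_sub_one_sub_pow_le {lam : ℝ → ℝ} (hmono : MonotoneOn lam (Set.Icc 0 1))
    (hmaps : Set.MapsTo lam (Set.Icc 0 1) (Set.Icc 0 1)) (hlam0 : lam 0 = 0) {c : ℝ}
    (hthr : ∀ x ∈ Set.Ioc (0 : ℝ) 1, lam (1 - Real.exp (-(c * x))) ≤ x)
    (hc : 0 ≤ c) {r : ℝ} (hr0 : 0 < r) {n : ℕ} (hn : 0 < n) (hcn : c / n < 1)
    (hr : 1 ≤ r * (1 - c / n)) {y : ℝ} (hy : y ∈ Set.Icc (0 : ℝ) 1) :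
    0 ≤ lam (1 - (1 - c * y / n) ^ n) ∧ lam (1 - (1 - c * y / n) ^ n) ≤ r * y := by
  have hn' : (0 : ℝ) < n := Nat.cast_pos.mpr hn
  have hu0 : 0 ≤ c * y / n := div_nonneg (mul_nonneg hc hy.1) hn'.le
  have hule : c * y / n ≤ c / n :=
    div_le_div_of_nonneg_right (mul_le_of_le_one_right hc hy.2) hn'.le
  have hu1 : c * y / n < 1 := hule.trans_lt hcn
  have hmem : 1 - (1 - c * y / n) ^ n ∈ Set.Icc (0 : ℝ) 1 := by
    have h1 : (1 - c * y / n) ^ n ≤ 1 := pow_le_one₀ (by linarith) (by linarith)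
    have h2 : 0 ≤ (1 - c * y / n) ^ n := pow_nonneg (by linarith) n
    constructor <;> linarith
  refine ⟨(hmaps hmem).1, ?_⟩
  rcases hy.1.eq_or_lt with rfl | hy0
  · simp [hlam0]
  rcases le_or_gt (r * y) 1 with hry | hry
  · have hpos : 0 < r * y := mul_pos hr0 hy0
    refine le_trans (hmono hmem ?_ ?_) (hthr _ ⟨hpos, hry⟩)
    · have h1 : Real.exp (-(c * (r * y))) ≤ 1 :=
        Real.exp_le_one_iff.mpr (neg_nonpos.mpr (mul_nonneg hc hpos.le))
      have h2 := Real.exp_pos (-(c * (r * y)))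
      constructor <;> linarith
    · have h := Real.exp_neg_mul_le_one_sub_pow hu0 hu1
        (hr.trans (mul_le_mul_of_nonneg_left (by linarith) hr0.le)) n
      have he : (n : ℝ) * (c * y / n) * r = c * (r * y) := by field_simp
      rw [he] at h
      linarith
  · exact (hmaps hmem).2.trans hry.le

/-- BEC high-rate scaling law, success direction: for a check-regular LDPC ensemble with
variable degree distribution `lam` (continuous, nondecreasing, mapping `[0,1]` to `[0,1]`,
`lam 0 = 0`), average symbol degree `j ≥ 2`, α-threshold witness `ᾱ` satisfying
`lam (1 - exp (-ᾱ·j·x)) ≤ x` on `(0,1]`, and `0 < α < ᾱ`, there is a `K` such that for all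
`k ≥ K` (with `k - 1 ≥ ᾱ·j`), the scaled density-evolution recursion
`y₀ = 1`, `y_{i+1} = f_k (y_i)` with
`f_k y = (α/ᾱ)·lam (1 - (1 - ᾱ·j·y/(k-1))^(k-1))` converges to `0`. -/
theorem stmt_1 (j : ℝ) (hj : 2 ≤ j) (lam : ℝ → ℝ)
    (hcont : ContinuousOn lam (Set.Icc 0 1))
    (hmono : MonotoneOn lam (Set.Icc 0 1))
    (hmaps : Set.MapsTo lam (Set.Icc 0 1) (Set.Icc 0 1))
    (hlam0 : lam 0 = 0)
    (abar : ℝ) (habar : 0 < abar)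
    (hthr : ∀ x ∈ Set.Ioc (0 : ℝ) 1, lam (1 - Real.exp (-(abar * j * x))) ≤ x)
    (α : ℝ) (hα : 0 < α) (hαlt : α < abar) :
    ∃ K : ℕ, ∀ k : ℕ, K ≤ k → abar * j ≤ (k : ℝ) - 1 →
      Tendsto (fun i : ℕ =>
          (fun y : ℝ => α / abar * lam (1 - (1 - abar * j * y / ((k : ℝ) - 1)) ^ (k - 1)))^[i] 1)
        atTop (nhds 0) := by
  have ha0 : 0 < α / abar := div_pos hα habar
  have ha1 : α / abar < 1 := (div_lt_one habar).mpr hαlt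
  set a := α / abar with ha
  have hc : 0 < abar * j := mul_pos habar (by linarith)
  set c := abar * j with hcdef
  obtain ⟨N, hN⟩ := exists_nat_ge (c / ((1 - a) / 2))
  refine ⟨N + 2, fun k hk _ => ?_⟩
  obtain ⟨n, rfl⟩ : ∃ n, k = n + 1 := ⟨k - 1, by omega⟩
  have hn : 0 < n := by omega
  have hn' : (0 : ℝ) < n := Nat.cast_pos.mpr hn
  have hNn : (N : ℝ) ≤ n := Nat.cast_le.mpr (by omega)
  have hcn : c / n ≤ (1 - a) / 2 := (div_le_comm₀ (by linarith) hn').mp (hN.trans hNn)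
  have hr0 : 0 < 2 / (1 + a) := by positivity
  have hr : 1 ≤ 2 / (1 + a) * (1 - c / n) := by
    rw [div_mul_eq_mul_div, one_le_div (by linarith)]
    linarith
  have hq1 : a * (2 / (1 + a)) < 1 := by
    rw [← mul_div_assoc, div_lt_one (by linarith)]
    linarith
  simp only [Nat.cast_add, Nat.cast_one, add_sub_cancel_right, Nat.add_sub_cancel]
  refine tendsto_iterate_zero_of_le_mul (mul_pos ha0 hr0).le hq1 (fun y hy => ?_) (by simp)
  obtain ⟨h1, h2⟩ := lam_one_sub_one_sub_pow_le hmono hmaps hlam0 hthr hc.le hr0 hn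
    (by linarith) hr hy
  exact ⟨mul_nonneg ha0.le h1, (mul_le_mul_of_nonneg_left h2 ha0.le).trans_eq (by ring)⟩
end

section
/- Let j ≥ 3 be an integer. Then: (a) there is a unique real number y* > 0 satisfying exp(y*) = (j−1)·y* + 1; (b) the function φ(y) = y/(j·(1 − exp(−y))^{j−1}) on (0,∞) attains its infimum exactly at y = y*; and (c) the supremum of the set of α > 0 such that (1 − exp(−α·j·x))^{j−1} ≤ x for all x ∈ (0,1] equals y*/(j·(1 − exp(−y*))^{j−1}). -/
theorem exp_lt_affine_of_lt {c s y : ℝ} (hs : Real.exp s = c * s + 1) (hy : 0 < y) (hys : y < s) :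
    Real.exp y < c * y + 1 := by
  have hs0 : 0 < s := hy.trans hys
  have h := strictConvexOn_exp.2 (Set.mem_univ 0) (Set.mem_univ s) hs0.ne
    (sub_pos.2 ((div_lt_one hs0).2 hys)) (div_pos hy hs0) (sub_add_cancel 1 (y / s))
  simp only [smul_eq_mul, mul_zero, zero_add, Real.exp_zero, hs, div_mul_cancel₀ y hs0.ne'] at h
  have e : (1 - y / s) * 1 + y / s * (c * s + 1) = c * y + 1 := by field_simp; ring
  linarith

theorem affine_lt_exp_of_lt {c s y : ℝ} (hs : Real.exp s = c * s + 1) (hs0 : 0 < s) (hsy : s < y) :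
    c * y + 1 < Real.exp y := by
  by_contra! hle
  set d := (Real.exp y - 1) / y with hd
  have hy : 0 < y := hs0.trans hsy
  have hdy : Real.exp y = d * y + 1 := by rw [hd]; field_simp; ring
  have hlt := exp_lt_affine_of_lt hdy hs0 hsy
  have hdc : d ≤ c := by
    rw [hd, div_le_iff₀ hy]; linarith
  nlinarith

theorem exists_pos_exp_eq_affine {c : ℝ} (hc : 2 ≤ c) :
    ∃ s : ℝ, 0 < s ∧ Real.exp s = c * s + 1 := by
  have hcont : ContinuousOn (fun y : ℝ => Real.exp y - (c * y + 1)) (Set.Icc (1 / 2) (2 * c)) := by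
    fun_prop
  have hlow : Real.exp (1 / 2) - (c * (1 / 2) + 1) ≤ 0 := by
    have h1 : Real.exp (1 / 2) * Real.exp (1 / 2) = Real.exp 1 := by
      rw [← Real.exp_add]; norm_num
    nlinarith [Real.exp_one_lt_d9, Real.exp_pos (1 / 2)]
  have hhigh : 0 ≤ Real.exp (2 * c) - (c * (2 * c) + 1) := by
    nlinarith [Real.quadratic_le_exp_of_nonneg (x := 2 * c) (by linarith)]
  obtain ⟨s, hs, h⟩ := intermediate_value_Icc (by linarith) hcont ⟨hlow, hhigh⟩
  exact ⟨s, by linarith [hs.1], by simpa [sub_eq_zero] using h⟩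

theorem one_sub_exp_neg_pos {y : ℝ} (hy : 0 < y) : 0 < 1 - Real.exp (-y) := by
  rw [sub_pos, Real.exp_lt_one_iff]; linarith

theorem hasDerivAt_log_sub_mul_log_one_sub_exp_neg (c : ℝ) {y : ℝ} (hy : 0 < y) :
    HasDerivAt (fun y : ℝ => Real.log y - c * Real.log (1 - Real.exp (-y)))
      ((Real.exp y - (c * y + 1)) / (y * (Real.exp y - 1))) y := by
  have hu := one_sub_exp_neg_pos hy
  have h1 : HasDerivAt (fun y : ℝ => 1 - Real.exp (-y)) (Real.exp (-y)) y := by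
    simpa using ((hasDerivAt_neg y).exp).const_sub 1
  have h2 := (Real.hasDerivAt_log hy.ne').sub ((h1.log hu.ne').const_mul c)
  refine h2.congr_deriv ?_
  have he : Real.exp y - 1 ≠ 0 := by
    have := Real.add_one_lt_exp hy.ne'
    linarith
  rw [Real.exp_neg] at hu ⊢
  have hE := Real.exp_pos y
  have e : (Real.exp y)⁻¹ / (1 - (Real.exp y)⁻¹) = 1 / (Real.exp y - 1) := by
    rw [div_eq_div_iff hu.ne' he]
    field_simp
  rw [e]
  field_simp
  ring

theorem log_sub_mul_log_one_sub_exp_neg_lt {c s y : ℝ} (hs0 : 0 < s)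
    (hs : Real.exp s = c * s + 1) (hy : 0 < y) (hne : y ≠ s) :
    Real.log s - c * Real.log (1 - Real.exp (-s)) <
      Real.log y - c * Real.log (1 - Real.exp (-y)) := by
  have hden : ∀ z : ℝ, 0 < z → 0 < z * (Real.exp z - 1) := fun z hz =>
    mul_pos hz (by linarith [Real.add_one_lt_exp hz.ne'])
  rcases hne.lt_or_gt with hlt | hgt
  · refine strictAntiOn_of_deriv_neg (convex_Icc y s)
      (fun z hz => (hasDerivAt_log_sub_mul_log_one_sub_exp_neg c
        (hy.trans_le hz.1)).continuousAt.continuousWithinAt) (fun z hz => ?_)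
      (Set.left_mem_Icc.2 hlt.le) (Set.right_mem_Icc.2 hlt.le) hlt
    rw [interior_Icc] at hz
    have hz0 := hy.trans hz.1
    rw [(hasDerivAt_log_sub_mul_log_one_sub_exp_neg c hz0).deriv]
    exact div_neg_of_neg_of_pos (sub_neg.2 (exp_lt_affine_of_lt hs hz0 hz.2)) (hden z hz0)
  · refine strictMonoOn_of_deriv_pos (convex_Icc s y)
      (fun z hz => (hasDerivAt_log_sub_mul_log_one_sub_exp_neg c
        (hs0.trans_le hz.1)).continuousAt.continuousWithinAt) (fun z hz => ?_)
      (Set.left_mem_Icc.2 hgt.le) (Set.right_mem_Icc.2 hgt.le) hgt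
    rw [interior_Icc] at hz
    have hz0 := hs0.trans hz.1
    rw [(hasDerivAt_log_sub_mul_log_one_sub_exp_neg c hz0).deriv]
    exact div_pos (sub_pos.2 (affine_lt_exp_of_lt hs hs0 hz.1)) (hden z hz0)

theorem div_one_sub_exp_neg_pow_lt {n : ℕ} {s y : ℝ} (hs0 : 0 < s)
    (hs : Real.exp s = n * s + 1) (hy : 0 < y) (hne : y ≠ s) :
    s / (1 - Real.exp (-s)) ^ n < y / (1 - Real.exp (-y)) ^ n := by
  have hus := one_sub_exp_neg_pos hs0
  have huy := one_sub_exp_neg_pos hy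
  rw [← Real.log_lt_log_iff (by positivity) (by positivity),
    Real.log_div hs0.ne' (by positivity), Real.log_div hy.ne' (by positivity),
    Real.log_pow, Real.log_pow]
  exact log_sub_mul_log_one_sub_exp_neg_lt hs0 hs hy hne

/-- If `y / (b * (1 - exp (-y)) ^ n)` is minimized over `y > 0` at `s`, then the admissible
parameters are exactly those up to the minimum. -/
theorem setOf_one_sub_exp_neg_pow_le_eq_Ioc {n : ℕ} {b s : ℝ} (hb : 0 < b) (hs0 : 0 < s)
    (hmin : ∀ y : ℝ, 0 < y →
      s / (b * (1 - Real.exp (-s)) ^ n) ≤ y / (b * (1 - Real.exp (-y)) ^ n)) :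
    {α : ℝ | 0 < α ∧ ∀ x ∈ Set.Ioc (0 : ℝ) 1, (1 - Real.exp (-(α * b * x))) ^ n ≤ x} =
      Set.Ioc 0 (s / (b * (1 - Real.exp (-s)) ^ n)) := by
  ext α
  simp only [Set.mem_ofPred_eq, Set.mem_Ioc]
  refine and_congr_right fun hα => ⟨fun h => ?_, fun h x hx => ?_⟩
  · have hus := one_sub_exp_neg_pos hs0
    have key : (1 - Real.exp (-s)) ^ n ≤ s / (α * b) := by
      rcases le_or_gt (s / (α * b)) 1 with hle | hgt
      · have := h (s / (α * b)) ⟨by positivity, hle⟩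
        rwa [mul_div_cancel₀ s (by positivity : α * b ≠ 0)] at this
      · exact (pow_le_one₀ hus.le (by linarith [Real.exp_pos (-s)])).trans hgt.le
    rw [le_div_iff₀ (by positivity)] at key ⊢
    linarith
  · have hx0 := hx.1
    have hy : 0 < α * b * x := by positivity
    have hu := one_sub_exp_neg_pos hy
    have key := h.trans (hmin _ hy)
    rw [le_div_iff₀ (by positivity)] at key
    refine le_of_mul_le_mul_left (a := α * b) ?_ (by positivity)
    linarith

/-- The α-threshold of the (j,k)-regular LDPC ensemble on the BEC, for `j ≥ 3`:
(a) there is a unique `y* > 0` with `exp y* = (j-1)·y* + 1`;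
(b) `φ(y) = y / (j·(1 - exp (-y))^(j-1))` attains its infimum on `(0,∞)` exactly at `y*`;
(c) the supremum of all `α > 0` such that `(1 - exp (-αjx))^(j-1) ≤ x` on `(0,1]`
equals `φ(y*)`. -/
theorem stmt_4 (j : ℕ) (hj : 3 ≤ j) :
    ∃ ystar : ℝ, 0 < ystar ∧ Real.exp ystar = ((j : ℝ) - 1) * ystar + 1 ∧
      (∀ y : ℝ, 0 < y → Real.exp y = ((j : ℝ) - 1) * y + 1 → y = ystar) ∧
      (∀ y : ℝ, 0 < y →
        ystar / ((j : ℝ) * (1 - Real.exp (-ystar)) ^ (j - 1)) ≤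
          y / ((j : ℝ) * (1 - Real.exp (-y)) ^ (j - 1))) ∧
      (∀ y : ℝ, 0 < y → y ≠ ystar →
        ystar / ((j : ℝ) * (1 - Real.exp (-ystar)) ^ (j - 1)) <
          y / ((j : ℝ) * (1 - Real.exp (-y)) ^ (j - 1))) ∧
      sSup {α : ℝ | 0 < α ∧ ∀ x ∈ Set.Ioc (0 : ℝ) 1,
          (1 - Real.exp (-(α * (j : ℝ) * x))) ^ (j - 1) ≤ x} =
        ystar / ((j : ℝ) * (1 - Real.exp (-ystar)) ^ (j - 1)) := by
  obtain ⟨n, rfl⟩ : ∃ n, j = n + 1 := ⟨j - 1, by omega⟩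
  have hn : (2 : ℝ) ≤ n := by exact_mod_cast (by omega : 2 ≤ n)
  have hc : ((n + 1 : ℕ) : ℝ) - 1 = n := by push_cast; ring
  rw [hc, Nat.add_sub_cancel]
  have hb : (0 : ℝ) < ((n + 1 : ℕ) : ℝ) := by positivity
  obtain ⟨s, hs0, hs⟩ := exists_pos_exp_eq_affine hn
  have hlt : ∀ y : ℝ, 0 < y → y ≠ s →
      s / (((n + 1 : ℕ) : ℝ) * (1 - Real.exp (-s)) ^ n) <
        y / (((n + 1 : ℕ) : ℝ) * (1 - Real.exp (-y)) ^ n) := fun y hy hne => by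
    rw [mul_comm, ← div_div, mul_comm, ← div_div]
    exact div_lt_div_of_pos_right (div_one_sub_exp_neg_pow_lt hs0 hs hy hne) hb
  have hle : ∀ y : ℝ, 0 < y →
      s / (((n + 1 : ℕ) : ℝ) * (1 - Real.exp (-s)) ^ n) ≤
        y / (((n + 1 : ℕ) : ℝ) * (1 - Real.exp (-y)) ^ n) := fun y hy => by
    rcases eq_or_ne y s with rfl | hne
    · exact le_rfl
    · exact (hlt y hy hne).le
  refine ⟨s, hs0, hs, fun y hy hye => ?_, hle, hlt, ?_⟩
  · rcases lt_trichotomy y s with h | h | h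
    · exact absurd hye (exp_lt_affine_of_lt hs hy h).ne
    · exact h
    · exact absurd hye (affine_lt_exp_of_lt hs hs0 h).ne'
  · have hus := one_sub_exp_neg_pos hs0
    rw [setOf_one_sub_exp_neg_pow_le_eq_Ioc hb hs0 hle, csSup_Ioc (by positivity)]
end

section
/- Let j ≥ 2 be an integer and define ᾱ_j as the supremum of the set of α > 0 such that (1 − exp(−α^{j−1}·x^{j−1}))^{j−1} ≤ x for all x ∈ (0,1] (one has ᾱ_j ≥ 1). Let α be a real number with 0 < α < ᾱ_j, and for each integer k with k − 1 > ᾱ_j^{j−1} define g_k(x) = (α/ᾱ_j)·(1 − [1 − (1 − α/(k−1)^{j/(j−1)})·(1 − (1 − ᾱ_j·x/(k−1)^{j/(j−1)})^{k−1})^{j−1} − ᾱ_j·x/(k−1)^{j/(j−1)}]^{k−1})^{j−1}. Then there exists K₁ < ∞ such that for every integer k ≥ K₁, the sequence defined by y_0 = 1 and y_{i+1} = g_k(y_i) converges to 0 as i → ∞. -/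
open Filter

/-- The scaled density-evolution map `g_k` for LM1 verification decoding of
(j,k)-regular LDPC codes on the q-ary symmetric channel, obtained via
`δ = α·(k-1)^{-j/(j-1)}`, `x_i = ᾱ_j·y_i·(k-1)^{-j/(j-1)}`. -/
noncomputable def gkLM1 (j : ℕ) (abar α : ℝ) (k : ℕ) (x : ℝ) : ℝ :=
  α / abar *
    (1 - (1 - (1 - α / ((k : ℝ) - 1) ^ ((j : ℝ) / ((j : ℝ) - 1))) *
      (1 - (1 - abar * x / ((k : ℝ) - 1) ^ ((j : ℝ) / ((j : ℝ) - 1))) ^ (k - 1)) ^ (j - 1) -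
      abar * x / ((k : ℝ) - 1) ^ ((j : ℝ) / ((j : ℝ) - 1))) ^ (k - 1)) ^ (j - 1)

/-- The map `g_k` in terms of the step `r = (k-1)^(-1/(j-1))`, where `m = j - 1`, `n = k - 1`. -/
lemma gkLM1_succ_succ {m n : ℕ} (hm : 1 ≤ m) (hn : 1 ≤ n) (a α x : ℝ) :
    gkLM1 (m + 1) a α (n + 1) x = α / a *
      (1 - (1 - (1 - α * ((n : ℝ) ^ (-(1 / (m : ℝ)))) ^ (m + 1)) *
        (1 - (1 - a * x * ((n : ℝ) ^ (-(1 / (m : ℝ)))) ^ (m + 1)) ^ n) ^ m -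
        a * x * ((n : ℝ) ^ (-(1 / (m : ℝ)))) ^ (m + 1)) ^ n) ^ m := by
  have hn' : (0 : ℝ) < n := by exact_mod_cast hn
  have hm' : (m : ℝ) ≠ 0 := by positivity
  have key : ((n : ℝ) ^ (-(1 / (m : ℝ)))) ^ (m + 1) =
      ((n : ℝ) ^ (((m + 1 : ℕ) : ℝ) / (((m + 1 : ℕ) : ℝ) - 1)))⁻¹ := by
    rw [← Real.rpow_natCast, ← Real.rpow_mul hn'.le, ← Real.rpow_neg hn'.le]
    congr 1
    push_cast
    rw [add_sub_cancel_right]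
    field_simp
  rw [key]
  simp only [gkLM1, Nat.add_sub_cancel, div_eq_mul_inv, Nat.cast_add, Nat.cast_one,
    add_sub_cancel_right]

lemma one_sub_one_sub_pow_le_mul {t : ℝ} (ht : t ≤ 1) (n : ℕ) :
    1 - (1 - t) ^ n ≤ n * t := by
  have := one_add_mul_le_pow (a := -t) (by linarith) n
  rw [← sub_eq_add_neg] at this
  linarith

lemma one_sub_one_sub_pow_le_exp {t : ℝ} (ht : t < 1) (n : ℕ) :
    1 - (1 - t) ^ n ≤ 1 - Real.exp (-(n * t / (1 - t))) := by
  have h1 : 0 < 1 - t := by linarith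
  have h : Real.exp (-(t / (1 - t))) ≤ 1 - t := by
    rw [Real.exp_neg]
    refine inv_le_of_inv_le₀ h1 (le_trans (le_of_eq ?_) (Real.add_one_le_exp _))
    field_simp
    ring
  have h2 := pow_le_pow_left₀ (Real.exp_pos _).le h n
  rw [← Real.exp_nat_mul] at h2
  have h3 : (n : ℝ) * -(t / (1 - t)) = -(n * t / (1 - t)) := by ring
  rw [h3] at h2
  linarith

/-- Bounds for the inner density-evolution expression by a single binomial-type term. -/
lemma lm1_inner_bounds {δ s : ℝ} {n m : ℕ} (hδ0 : 0 ≤ δ) (hδ : δ ≤ 1) (hs : 0 ≤ s)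
    (ht : (n * s) ^ m + s ≤ 1) :
    0 ≤ 1 - (1 - (1 - δ) * (1 - (1 - s) ^ n) ^ m - s) ^ n ∧
      1 - (1 - (1 - δ) * (1 - (1 - s) ^ n) ^ m - s) ^ n ≤
        1 - (1 - ((n * s) ^ m + s)) ^ n := by
  have hns : 0 ≤ ((n : ℝ) * s) ^ m := by positivity
  have hs1 : s ≤ 1 := by linarith
  have hp : (1 - s) ^ n ≤ 1 := pow_le_one₀ (by linarith) (by linarith)
  have hU0 : 0 ≤ (1 - (1 - s) ^ n) ^ m := pow_nonneg (by linarith) _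
  have hU : (1 - (1 - s) ^ n) ^ m ≤ (n * s) ^ m :=
    pow_le_pow_left₀ (by linarith) (one_sub_one_sub_pow_le_mul hs1 n) m
  have hV0 : 0 ≤ (1 - δ) * (1 - (1 - s) ^ n) ^ m := mul_nonneg (by linarith) hU0
  have hV : (1 - δ) * (1 - (1 - s) ^ n) ^ m ≤ (n * s) ^ m := by nlinarith
  constructor
  · linarith [pow_le_one₀ (n := n)
      (by linarith : 0 ≤ 1 - (1 - δ) * (1 - (1 - s) ^ n) ^ m - s) (by linarith)]
  · linarith [pow_le_pow_left₀ (by linarith : 0 ≤ 1 - ((n * s) ^ m + s))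
      (by linarith : 1 - ((n * s) ^ m + s) ≤ 1 - (1 - δ) * (1 - (1 - s) ^ n) ^ m - s) n]

lemma one_sub_exp_pow_le_div {m : ℕ} {β w : ℝ} (hm : 1 ≤ m) (hβ : 0 < β) (hw : 0 ≤ w)
    (hset : ∀ x ∈ Set.Ioc (0 : ℝ) 1, (1 - Real.exp (-(β ^ m * x ^ m))) ^ m ≤ x) :
    (1 - Real.exp (-w ^ m)) ^ m ≤ w / β := by
  rcases hw.eq_or_lt with rfl | hw
  · simp [zero_pow (by omega : m ≠ 0)]
  rcases le_or_gt (w / β) 1 with h | h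
  · have := hset (w / β) ⟨by positivity, h⟩
    rwa [← mul_pow, mul_div_cancel₀ _ hβ.ne'] at this
  · have h1 : Real.exp (-w ^ m) ≤ 1 := Real.exp_le_one_iff.2 (by simp; positivity)
    exact (pow_le_one₀ (by linarith) (by linarith [Real.exp_pos (-w ^ m)])).trans h.le

/-- Contraction estimate for the scaled map once the step `r` is small. -/
lemma lm1_map_bounds {m n : ℕ} (hm : 1 ≤ m) {a α β l ε r x : ℝ} (ha : 0 < a) (hα : 0 < α)
    (hβ : 0 < β) (hl : 1 < l) (hε : 0 < ε) (hr : 0 < r) (hnr : n * r ^ m = 1)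
    (hset : ∀ x ∈ Set.Ioc (0 : ℝ) 1, (1 - Real.exp (-(β ^ m * x ^ m))) ^ m ≤ x)
    (hε1 : ε ≤ 1) (hεa : a * (2 * ε) ≤ 1) (hεα : α * (2 * ε) ≤ α * l / β)
    (hrε : r ≤ ε) (hrα : α * r ^ (m + 1) ≤ 1)
    (hrl : 1 + (ε ^ (m - 1))⁻¹ * r ≤ l * (1 - (a ^ m * r ^ m + a * r ^ (m + 1))))
    (hx0 : 0 ≤ x) (hx1 : x ≤ 1) :
    0 ≤ α / a * (1 - (1 - (1 - α * r ^ (m + 1)) * (1 - (1 - a * x * r ^ (m + 1)) ^ n) ^ m -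
        a * x * r ^ (m + 1)) ^ n) ^ m ∧
      α / a * (1 - (1 - (1 - α * r ^ (m + 1)) * (1 - (1 - a * x * r ^ (m + 1)) ^ n) ^ m -
        a * x * r ^ (m + 1)) ^ n) ^ m ≤ α * l / β * x := by
  obtain ⟨X, hX⟩ : ∃ X, X = a * x := ⟨_, rfl⟩
  have hX0 : 0 ≤ X := by rw [hX]; positivity
  have hXa : X ≤ a := by rw [hX]; nlinarith
  rw [← hX]
  have hns : (n : ℝ) * (X * r ^ (m + 1)) = X * r := by
    rw [pow_succ]; linear_combination X * r * hnr
  have hT : X ^ m * r ^ m + X * r ^ (m + 1) ≤ a ^ m * r ^ m + a * r ^ (m + 1) := by gcongr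
  obtain ⟨t, ht⟩ : ∃ t, t = (n * (X * r ^ (m + 1))) ^ m + X * r ^ (m + 1) := ⟨_, rfl⟩
  have ht' : t = X ^ m * r ^ m + X * r ^ (m + 1) := by rw [ht, hns, mul_pow]
  have hnt : n * t = X ^ m + X * r := by
    rw [ht', pow_succ]; linear_combination (X ^ m + X * r) * hnr
  have hDr : 0 < (ε ^ (m - 1))⁻¹ * r := by positivity
  have hT1 : t < 1 := by
    by_contra! h
    nlinarith
  obtain ⟨hb0, hb⟩ := lm1_inner_bounds (n := n) (m := m)
    (by positivity : 0 ≤ α * r ^ (m + 1)) hrα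
    (by positivity : 0 ≤ X * r ^ (m + 1)) (by rw [← ht]; exact hT1.le)
  rw [← ht] at hb
  refine ⟨mul_nonneg (by positivity) (pow_nonneg hb0 _), ?_⟩
  by_cases hcase : X * ε ^ (m - 1) ≤ X ^ m
  · have h1t : 0 < 1 - t := by linarith
    have hw : n * t / (1 - t) ≤ (l * X) ^ m := by
      rw [div_le_iff₀ h1t, hnt, mul_pow]
      have h1 : X ≤ (ε ^ (m - 1))⁻¹ * X ^ m := by
        rw [inv_mul_eq_div, le_div_iff₀ (by positivity)]; exact hcase
      have h2 : l ≤ l ^ m := le_self_pow₀ hl.le (by omega)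
      have h3 : l * (1 - (a ^ m * r ^ m + a * r ^ (m + 1))) ≤ l ^ m * (1 - t) := by
        rw [← ht'] at hT
        calc _ ≤ l * (1 - t) := by gcongr
          _ ≤ _ := by gcongr
      have hXm : 0 ≤ X ^ m := by positivity
      calc X ^ m + X * r ≤ X ^ m + (ε ^ (m - 1))⁻¹ * X ^ m * r := by gcongr
        _ = X ^ m * (1 + (ε ^ (m - 1))⁻¹ * r) := by ring
        _ ≤ X ^ m * (l ^ m * (1 - t)) := by gcongr; exact hrl.trans h3
        _ = _ := by ring
    have h4 := one_sub_one_sub_pow_le_exp hT1 n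
    have h5 : Real.exp (-(l * X) ^ m) ≤ Real.exp (-(n * t / (1 - t))) :=
      Real.exp_le_exp.2 (by linarith)
    have h6 := (pow_le_pow_left₀ hb0 (hb.trans (h4.trans (sub_le_sub_left h5 1))) m).trans
      (one_sub_exp_pow_le_div (w := l * X) hm hβ (by positivity) hset)
    refine (mul_le_mul_of_nonneg_left h6 (by positivity)).trans (le_of_eq ?_)
    rw [hX]
    field_simp
  · have hm2 : 2 ≤ m := by
      by_contra! h
      obtain rfl : m = 1 := by omega
      simp at hcase
    have hXε : X < ε := by
      by_contra! h
      refine hcase ?_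
      calc X * ε ^ (m - 1) ≤ X * X ^ (m - 1) := by gcongr
        _ = X ^ m := by rw [← pow_succ', Nat.sub_add_cancel hm]
    have h1 : n * t ≤ X * (2 * ε) := by
      have h2 : X ^ (m - 1) ≤ ε := (pow_le_pow_left₀ hX0 hXε.le _).trans
        (pow_le_of_le_one hε.le hε1 (by omega))
      have h3 : X ^ m = X * X ^ (m - 1) := by rw [← pow_succ', Nat.sub_add_cancel hm]
      rw [hnt, h3]
      nlinarith
    have h2 : X * (2 * ε) ≤ 1 := le_trans (by gcongr) hεa
    have h3 := hb.trans ((one_sub_one_sub_pow_le_mul hT1.le n).trans h1)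
    calc _ ≤ α / a * (X * (2 * ε)) := by
          gcongr
          exact (pow_le_of_le_one hb0 (h3.trans h2) (by omega)).trans h3
      _ = α * (2 * ε) * x := by rw [hX]; field_simp
      _ ≤ _ := by gcongr

lemma tendsto_iterate_zero_of_contraction {f : ℝ → ℝ} {c : ℝ} (hc0 : 0 ≤ c) (hc : c < 1)
    (hf : ∀ x, 0 ≤ x → x ≤ 1 → 0 ≤ f x ∧ f x ≤ c * x) :
    Tendsto (fun i : ℕ => f^[i] 1) atTop (nhds 0) := by
  have h : ∀ i : ℕ, 0 ≤ f^[i] 1 ∧ f^[i] 1 ≤ c ^ i := by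
    intro i
    induction i with
    | zero => simp
    | succ i ih =>
      rw [Function.iterate_succ_apply', pow_succ']
      obtain ⟨h0, h1⟩ := hf _ ih.1 (ih.2.trans (pow_le_one₀ hc0 hc.le))
      exact ⟨h0, h1.trans (mul_le_mul_of_nonneg_left ih.2 hc0)⟩
  exact squeeze_zero (fun i => (h i).1) (fun i => (h i).2)
    (tendsto_pow_atTop_nhds_zero_of_lt_one hc0 hc)

/-- Theorem 3 (success direction) for LM1 on the q-SC: with
`ᾱ_j = sup {α > 0 : (1 - exp (-α^(j-1) x^(j-1)))^(j-1) ≤ x on (0,1]}` and `0 < α < ᾱ_j`,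
there is a `K₁` such that for all integers `k ≥ K₁` (with `k - 1 > ᾱ_j^(j-1)`), the scaled
LM1 density-evolution recursion `y₀ = 1`, `y_{i+1} = g_k (y_i)` converges to `0`. -/
theorem stmt_7 (j : ℕ) (hj : 2 ≤ j) (abar : ℝ)
    (habar : abar = sSup {α : ℝ | 0 < α ∧ ∀ x ∈ Set.Ioc (0 : ℝ) 1,
      (1 - Real.exp (-(α ^ (j - 1) * x ^ (j - 1)))) ^ (j - 1) ≤ x})
    (α : ℝ) (hα : 0 < α) (hαlt : α < abar) :
    ∃ K₁ : ℕ, ∀ k : ℕ, K₁ ≤ k → abar ^ (j - 1) < (k : ℝ) - 1 →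
      Tendsto (fun i : ℕ => (fun y : ℝ => gkLM1 j abar α k y)^[i] 1) atTop (nhds 0) := by
  obtain ⟨m, rfl⟩ : ∃ m, j = m + 1 := ⟨j - 1, by omega⟩
  have hm : 1 ≤ m := by omega
  simp only [Nat.add_sub_cancel] at habar ⊢
  have ha : 0 < abar := hα.trans hαlt
  have hlt := hαlt
  rw [habar] at hlt
  obtain ⟨β, ⟨hβ, hset⟩, hαβ⟩ := exists_lt_of_lt_csSup (by
    rw [Set.nonempty_iff_ne_empty]
    intro h
    rw [h, Real.sSup_empty] at habar
    linarith) hlt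
  obtain ⟨l, hl, hlβ⟩ : ∃ l, 1 < l ∧ l < β / α :=
    exists_between ((one_lt_div hα).2 hαβ)
  have hc : α * l / β < 1 := by
    rw [lt_div_iff₀ hα] at hlβ
    rw [div_lt_one hβ]
    linarith
  have hev : ∀ b c : ℝ, 0 < c → ∀ᶠ ε in nhdsWithin (0 : ℝ) (Set.Ioi 0), b * (2 * ε) ≤ c := by
    intro b c hc
    have : Tendsto (fun ε : ℝ => b * (2 * ε)) (nhds 0) (nhds (b * (2 * 0))) :=
      Continuous.tendsto (by fun_prop) 0
    exact ((this.eventually_lt_const (by simpa using hc)).filter_mono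
      nhdsWithin_le_nhds).mono fun _ h => h.le
  obtain ⟨ε, hε1, hεa, hεα, hε⟩ := ((hev 1 1 one_pos).and ((hev abar 1 one_pos).and
    ((hev α (α * l / β) (by positivity)).and self_mem_nhdsWithin))).exists
  have hr1 : ∀ᶠ r in nhds (0 : ℝ), r < ε := gt_mem_nhds hε
  have hr2 : ∀ᶠ r in nhds (0 : ℝ), α * r ^ (m + 1) < 1 :=
    (Continuous.tendsto (by fun_prop) 0).eventually_lt_const (by simp)
  have hr3 : ∀ᶠ r in nhds (0 : ℝ), 1 + (ε ^ (m - 1))⁻¹ * r <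
      l * (1 - (abar ^ m * r ^ m + abar * r ^ (m + 1))) :=
    Tendsto.eventually_lt (Continuous.tendsto (by fun_prop) 0)
      (Continuous.tendsto (by fun_prop) 0) (by simpa [zero_pow (by omega : m ≠ 0)] using hl)
  have hlim : Tendsto (fun n : ℕ => (n : ℝ) ^ (-(1 / (m : ℝ)))) atTop (nhds 0) :=
    (tendsto_rpow_neg_atTop (by positivity)).comp tendsto_natCast_atTop_atTop
  obtain ⟨K, hK⟩ := eventually_atTop.1 (hlim.eventually (hr1.and (hr2.and hr3)))
  refine ⟨K + 2, fun k hk _ => ?_⟩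
  obtain ⟨n, rfl⟩ : ∃ n, k = n + 1 := ⟨k - 1, by omega⟩
  have hn : 1 ≤ n := by omega
  have hn' : (0 : ℝ) < n := by exact_mod_cast hn
  obtain ⟨h1, h2, h3⟩ := hK n (by omega)
  refine tendsto_iterate_zero_of_contraction (by positivity) hc fun x hx0 hx1 => ?_
  rw [gkLM1_succ_succ hm hn]
  refine lm1_map_bounds hm ha hα hβ hl hε (by positivity) ?_ hset (by linarith) hεa hεα
    h1.le h2.le h3.le hx0 hx1
  rw [← Real.rpow_natCast, ← Real.rpow_mul hn'.le, neg_mul, one_div,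
    inv_mul_cancel₀ (by positivity), Real.rpow_neg_one, mul_inv_cancel₀ hn'.ne']
end

section
/- Let j ≥ 2 be an integer and define ᾱ_j as the supremum of the set of α > 0 such that (1 − exp(−α^{j−1}·x^{j−1}))^{j−1} ≤ x for all x ∈ (0,1]. Let α > ᾱ_j, and for each integer k with k − 1 > max(α, ᾱ_j)^{j−1} define g_k(x) = (α/ᾱ_j)·(1 − [1 − (1 − α/(k−1)^{j/(j−1)})·(1 − (1 − ᾱ_j·x/(k−1)^{j/(j−1)})^{k−1})^{j−1} − ᾱ_j·x/(k−1)^{j/(j−1)}]^{k−1})^{j−1}. Then there exists K₂ < ∞ such that for every integer k ≥ K₂, the sequence defined by y_0 = 1 and y_{i+1} = g_k(y_i) does not converge to 0. -/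
open Filter

/-- The set whose supremum is the high-rate scaling threshold of LM1 decoding. -/
def admissibleLM1 (j : ℕ) : Set ℝ :=
  {α : ℝ | 0 < α ∧ ∀ x ∈ Set.Ioc (0 : ℝ) 1,
    (1 - Real.exp (-(α ^ (j - 1) * x ^ (j - 1)))) ^ (j - 1) ≤ x}

lemma one_mem_admissibleLM1 {j : ℕ} (hj : 2 ≤ j) : (1 : ℝ) ∈ admissibleLM1 j := by
  refine ⟨one_pos, fun x hx => ?_⟩
  have hm : j - 1 ≠ 0 := by omega
  have hexp := Real.add_one_le_exp (-(1 ^ (j - 1) * x ^ (j - 1)))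
  have hpow : x ^ (j - 1) ≤ x := pow_le_of_le_one hx.1.le hx.2 hm
  have hnonneg : 0 ≤ 1 - Real.exp (-(1 ^ (j - 1) * x ^ (j - 1))) := by
    have := pow_nonneg hx.1.le (j - 1)
    rw [sub_nonneg, Real.exp_le_one_iff]
    simpa using this
  have hlt : 1 - Real.exp (-(1 ^ (j - 1) * x ^ (j - 1))) ≤ 1 := by
    linarith [Real.exp_pos (-(1 ^ (j - 1) * x ^ (j - 1)))]
  refine (pow_le_of_le_one hnonneg hlt hm).trans ?_
  rw [one_pow, one_mul] at hexp ⊢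
  linarith

lemma bddAbove_admissibleLM1 {j : ℕ} (hj : 2 ≤ j) : BddAbove (admissibleLM1 j) := by
  have hm : j - 1 ≠ 0 := by omega
  have hlim : Tendsto
      (fun α : ℝ => (1 - Real.exp (-(α ^ (j - 1) * (1 / 2 : ℝ) ^ (j - 1)))) ^ (j - 1))
      atTop (nhds 1) := by
    have h : Tendsto (fun α : ℝ => α ^ (j - 1) * (1 / 2 : ℝ) ^ (j - 1)) atTop atTop :=
      (tendsto_pow_atTop hm).atTop_mul_const (by positivity)
    simpa using ((Real.tendsto_exp_neg_atTop_nhds_zero.comp h).const_sub 1).pow (j - 1)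
  obtain ⟨A, hA⟩ := eventually_atTop.1 (hlim.eventually (lt_mem_nhds (by norm_num : (1 / 2 : ℝ) < 1)))
  refine ⟨A, fun α hα => le_of_lt ?_⟩
  by_contra! hlt
  exact absurd (hα.2 (1 / 2) (by norm_num)) (not_le.2 (hA α hlt))

/-- Above the threshold, the limiting map exceeds the identity somewhere on `(0, 1]`. -/
lemma exists_lt_limit_map {j : ℕ} (hj : 2 ≤ j) {abar α : ℝ}
    (habar : abar = sSup (admissibleLM1 j)) (hα : abar < α) :
    ∃ y ∈ Set.Ioc (0 : ℝ) 1,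
      y < α / abar * (1 - Real.exp (-(abar * y) ^ (j - 1))) ^ (j - 1) := by
  have hm : j - 1 ≠ 0 := by omega
  have hone : 1 ≤ abar :=
    habar ▸ le_csSup (bddAbove_admissibleLM1 hj) (one_mem_admissibleLM1 hj)
  have habar0 : 0 < abar := by linarith
  have hα0 : 0 < α := by linarith
  set c := (1 - Real.exp (-α ^ (j - 1))) ^ (j - 1) with hc
  have hbase : 0 < 1 - Real.exp (-α ^ (j - 1)) := by
    rw [sub_pos, Real.exp_lt_one_iff, neg_lt_zero]
    positivity
  have hc0 : 0 < c := pow_pos hbase _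
  have hc1 : c < 1 := pow_lt_one₀ hbase.le (by linarith [Real.exp_pos (-α ^ (j - 1))]) hm
  have habarc : abar < abar / c := by
    rw [lt_div_iff₀ hc0]
    nlinarith
  obtain ⟨β, hβ, hβ'⟩ := exists_between (lt_min hα habarc)
  have hβα := hβ'.trans_le (min_le_left _ _)
  have hβc := hβ'.trans_le (min_le_right _ _)
  have hβ0 : 0 < β := habar0.trans hβ
  have hnot : β ∉ admissibleLM1 j := fun h =>
    hβ.not_ge (habar ▸ le_csSup (bddAbove_admissibleLM1 hj) h)
  have hex : ∃ x ∈ Set.Ioc (0 : ℝ) 1,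
      x < (1 - Real.exp (-(β ^ (j - 1) * x ^ (j - 1)))) ^ (j - 1) := by
    by_contra! h
    exact hnot ⟨hβ0, h⟩
  obtain ⟨x, hx, hlt⟩ := hex
  rw [← mul_pow] at hlt
  have hx0 := hx.1
  have hxc : x < c := by
    refine hlt.trans_le (pow_le_pow_left₀ ?_ ?_ _)
    · rw [sub_nonneg, Real.exp_le_one_iff, neg_nonpos]
      positivity
    · have : β * x ≤ α := by nlinarith [hx.2]
      gcongr
  refine ⟨β * x / abar, ⟨by positivity, ?_⟩, ?_⟩
  · rw [div_le_one habar0]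
    rw [lt_div_iff₀ hc0] at hβc
    nlinarith
  · rw [mul_div_cancel₀ _ habar0.ne', mul_div_right_comm]
    have h1 : β / abar * x < α / abar * x := by gcongr
    exact h1.trans (by gcongr)

/-- The argument of the outer power in `gkLM1` is nonnegative. -/
lemma gkLM1_inner_nonneg {P a d u : ℝ} (n m : ℕ) (hP : 0 < P) (hd : d ≤ P) (hu : 0 ≤ a * u)
    (hud : a * u ≤ d) :
    0 ≤ 1 - (1 - d / P) * (1 - (1 - a * u / P) ^ n) ^ m - a * u / P := by
  have hdP : d / P ≤ 1 := (div_le_one hP).2 hd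
  have huP : a * u / P ≤ d / P := by gcongr
  have hu0 : 0 ≤ a * u / P := by positivity
  have h0 : 0 ≤ (1 - a * u / P) ^ n := pow_nonneg (by linarith) _
  have h1 : (1 - a * u / P) ^ n ≤ 1 := pow_le_one₀ (by linarith) (by linarith)
  have h2 : (1 - (1 - a * u / P) ^ n) ^ m ≤ 1 := pow_le_one₀ (by linarith) (by linarith)
  nlinarith

/-- The argument of the outer power in `gkLM1` is antitone. -/
lemma gkLM1_inner_anti {P a d u v : ℝ} (n m : ℕ) (hP : 0 < P) (ha : 0 < a) (hd : d ≤ P)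
    (hu : 0 ≤ u) (huv : u ≤ v) (hvd : a * v ≤ d) :
    1 - (1 - d / P) * (1 - (1 - a * v / P) ^ n) ^ m - a * v / P ≤
      1 - (1 - d / P) * (1 - (1 - a * u / P) ^ n) ^ m - a * u / P := by
  have hdP : d / P ≤ 1 := (div_le_one hP).2 hd
  have hvP : a * v / P ≤ d / P := by gcongr
  have huvP : a * u / P ≤ a * v / P := by gcongr
  have hu0 : 0 ≤ a * u / P := by positivity
  have h1 : (1 - a * u / P) ^ n ≤ 1 := pow_le_one₀ (by linarith) (by linarith)
  have h2 : (1 - a * v / P) ^ n ≤ (1 - a * u / P) ^ n :=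
    pow_le_pow_left₀ (by linarith) (by linarith) _
  have h3 : (1 - (1 - a * u / P) ^ n) ^ m ≤ (1 - (1 - a * v / P) ^ n) ^ m :=
    pow_le_pow_left₀ (by linarith) (by linarith) _
  have h4 := mul_le_mul_of_nonneg_left h3 (by linarith : 0 ≤ 1 - d / P)
  linarith

lemma gkLM1_inner_zero {P a d : ℝ} {m : ℕ} (n : ℕ) (hm : m ≠ 0) :
    1 - (1 - d / P) * (1 - (1 - a * 0 / P) ^ n) ^ m - a * 0 / P = 1 := by
  simp [hm]

section

variable {j k : ℕ} {abar α : ℝ}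

lemma gkLM1_mono (hj : 2 ≤ j) (habar : 0 < abar) (hα : 0 < α)
    (hP : 0 < ((k : ℝ) - 1) ^ ((j : ℝ) / ((j : ℝ) - 1)))
    (hαP : α ≤ ((k : ℝ) - 1) ^ ((j : ℝ) / ((j : ℝ) - 1)))
    {u v : ℝ} (hu : 0 ≤ u) (huv : u ≤ v) (hv : v ≤ α / abar) :
    gkLM1 j abar α k u ≤ gkLM1 j abar α k v := by
  have hm : j - 1 ≠ 0 := by omega
  rw [le_div_iff₀ habar, mul_comm] at hv
  have huα : abar * u ≤ α := (mul_le_mul_of_nonneg_left huv habar.le).trans hv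
  have hv0 := gkLM1_inner_nonneg (k - 1) (j - 1) hP hαP
    (mul_nonneg habar.le (hu.trans huv)) hv
  have hu0 := gkLM1_inner_nonneg (k - 1) (j - 1) hP hαP (mul_nonneg habar.le hu) huα
  have hu1 := gkLM1_inner_anti (k - 1) (j - 1) hP habar hαP le_rfl hu huα
  rw [gkLM1_inner_zero _ hm] at hu1
  have hanti := gkLM1_inner_anti (k - 1) (j - 1) hP habar hαP hu huv hv
  unfold gkLM1
  refine mul_le_mul_of_nonneg_left (pow_le_pow_left₀ ?_ ?_ _) (by positivity)
  · exact sub_nonneg.2 (pow_le_one₀ hu0 hu1)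
  · exact sub_le_sub_left (pow_le_pow_left₀ hv0 hanti _) _

lemma gkLM1_le (hj : 2 ≤ j) (habar : 0 < abar) (hα : 0 < α)
    (hP : 0 < ((k : ℝ) - 1) ^ ((j : ℝ) / ((j : ℝ) - 1)))
    (hαP : α ≤ ((k : ℝ) - 1) ^ ((j : ℝ) / ((j : ℝ) - 1)))
    {u : ℝ} (hu : 0 ≤ u) (huα : u ≤ α / abar) :
    gkLM1 j abar α k u ≤ α / abar := by
  have hm : j - 1 ≠ 0 := by omega
  rw [le_div_iff₀ habar, mul_comm] at huα
  have hu0 := gkLM1_inner_nonneg (k - 1) (j - 1) hP hαP (mul_nonneg habar.le hu) huα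
  have hu1 := gkLM1_inner_anti (k - 1) (j - 1) hP habar hαP le_rfl hu huα
  rw [gkLM1_inner_zero _ hm] at hu1
  unfold gkLM1
  refine mul_le_of_le_one_right (by positivity) (pow_le_one₀ ?_ ?_)
  · exact sub_nonneg.2 (pow_le_one₀ hu0 hu1)
  · exact sub_le_self _ (pow_nonneg hu0 _)

/-- A lower bound for `gkLM1` with the same limit as `k → ∞`. -/
lemma le_gkLM1 (hj : 2 ≤ j) (hk : 2 ≤ k) (habar : 0 < abar) (hα : 0 < α)
    (hαP : α ≤ ((k : ℝ) - 1) ^ ((j : ℝ) / ((j : ℝ) - 1)))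
    {y : ℝ} (hy : 0 ≤ y) (hyα : y ≤ α / abar) :
    α / abar * (1 - Real.exp (-((1 - α / ((k : ℝ) - 1) ^ ((j : ℝ) / ((j : ℝ) - 1))) *
      ((1 - Real.exp (-(abar * y * ((k : ℝ) - 1) ^ (-(1 / ((j : ℝ) - 1)))))) /
        ((k : ℝ) - 1) ^ (-(1 / ((j : ℝ) - 1)))) ^ (j - 1)))) ^ (j - 1) ≤
      gkLM1 j abar α k y := by
  have hj1 : (0 : ℝ) < (j : ℝ) - 1 := by
    have : (2 : ℝ) ≤ j := by exact_mod_cast hj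
    linarith
  have hn : ((k - 1 : ℕ) : ℝ) = (k : ℝ) - 1 := by
    rw [Nat.cast_sub (by omega), Nat.cast_one]
  have hjm : ((j - 1 : ℕ) : ℝ) = (j : ℝ) - 1 := by
    rw [Nat.cast_sub (by omega), Nat.cast_one]
  have hR : (0 : ℝ) < (k : ℝ) - 1 := by
    have : (2 : ℝ) ≤ k := by exact_mod_cast hk
    linarith
  rw [le_div_iff₀ habar, mul_comm] at hyα
  have hay : 0 ≤ abar * y := mul_nonneg habar.le hy
  unfold gkLM1
  set R := (k : ℝ) - 1
  set P := R ^ ((j : ℝ) / ((j : ℝ) - 1)) with hPdef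
  set r := R ^ (-(1 / ((j : ℝ) - 1))) with hrdef
  have hP : 0 < P := Real.rpow_pos_of_pos hR _
  have hr : 0 < r := Real.rpow_pos_of_pos hR _
  have hrP : R / P = r := by
    rw [hPdef, hrdef, eq_comm, eq_div_iff hP.ne', hPdef, ← Real.rpow_add hR]
    convert Real.rpow_one R using 2
    field_simp
    ring
  have hrm : R * r ^ (j - 1) = 1 := by
    rw [hrdef, ← Real.rpow_natCast, ← Real.rpow_mul hR.le, hjm, neg_mul,
      one_div_mul_cancel hj1.ne', Real.rpow_neg_one, mul_inv_cancel₀ hR.ne']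
  have hdP : α / P ≤ 1 := (div_le_one hP).2 hαP
  have huP : abar * y / P ≤ α / P := by gcongr
  have hu0 : 0 ≤ abar * y / P := by positivity
  have hinner : (1 - abar * y / P) ^ (k - 1) ≤ Real.exp (-(abar * y * r)) := by
    refine (pow_le_pow_left₀ (by linarith) (Real.one_sub_le_exp_neg _) _).trans_eq ?_
    rw [← Real.exp_nat_mul, hn, ← hrP]
    congr 1
    ring
  have hexp : Real.exp (-(abar * y * r)) ≤ 1 := by
    rw [Real.exp_le_one_iff, neg_nonpos]
    positivity
  have h3 : (1 - Real.exp (-(abar * y * r))) ^ (j - 1) ≤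
      (1 - (1 - abar * y / P) ^ (k - 1)) ^ (j - 1) :=
    pow_le_pow_left₀ (by linarith) (by linarith) _
  have h4 := mul_le_mul_of_nonneg_left h3 (by linarith : 0 ≤ 1 - α / P)
  have hnonneg := gkLM1_inner_nonneg (k - 1) (j - 1) hP hαP hay hyα
  have houter : (1 - (1 - α / P) * (1 - (1 - abar * y / P) ^ (k - 1)) ^ (j - 1) -
      abar * y / P) ^ (k - 1) ≤
      Real.exp (-((1 - α / P) * ((1 - Real.exp (-(abar * y * r))) / r) ^ (j - 1))) := by
    refine (pow_le_pow_left₀ hnonneg (le_trans (by linarith) (Real.one_sub_le_exp_neg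
      ((1 - α / P) * (1 - Real.exp (-(abar * y * r))) ^ (j - 1)))) _).trans_eq ?_
    rw [← Real.exp_nat_mul, hn, div_pow]
    have : R = 1 / r ^ (j - 1) := by
      rw [eq_div_iff (by positivity), hrm]
    rw [this]
    congr 1
    ring
  refine mul_le_mul_of_nonneg_left (pow_le_pow_left₀ ?_ ?_ _) (by positivity)
  · rw [sub_nonneg, Real.exp_le_one_iff, neg_nonpos]
    exact mul_nonneg (by linarith) (pow_nonneg (div_nonneg (by linarith) hr.le) _)
  · linarith

end

lemma tendsto_one_sub_exp_neg_mul_div (a : ℝ) :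
    Tendsto (fun r : ℝ => (1 - Real.exp (-(a * r))) / r) (nhdsWithin 0 (Set.Ioi 0))
      (nhds a) := by
  have h : HasDerivAt (fun r : ℝ => 1 - Real.exp (-(a * r))) a 0 := by
    simpa using (((hasDerivAt_id (0 : ℝ)).const_mul a).neg.exp).const_sub 1
  have h' := (hasDerivAt_iff_tendsto_slope.1 h).mono_left
    (nhdsWithin_mono 0 (fun x (hx : 0 < x) => hx.ne'))
  refine h'.congr fun r => ?_
  simp [slope_def_field]

/-- A point strictly below its image under the limiting map is eventually strictly below its
image under `gkLM1`. -/
lemma eventually_lt_gkLM1 {j : ℕ} (hj : 2 ≤ j) {abar α y : ℝ} (habar : 0 < abar) (hα : 0 < α)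
    (hy : 0 ≤ y) (hyα : y ≤ α / abar)
    (hlt : y < α / abar * (1 - Real.exp (-(abar * y) ^ (j - 1))) ^ (j - 1)) :
    ∀ᶠ k : ℕ in atTop, 2 ≤ k ∧ α ≤ ((k : ℝ) - 1) ^ ((j : ℝ) / ((j : ℝ) - 1)) ∧
      y < gkLM1 j abar α k y := by
  have hj1 : (0 : ℝ) < (j : ℝ) - 1 := by
    have : (2 : ℝ) ≤ j := by exact_mod_cast hj
    linarith
  have hR : Tendsto (fun k : ℕ => (k : ℝ) - 1) atTop atTop :=
    tendsto_atTop_add_const_right _ _ tendsto_natCast_atTop_atTop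
  have hP : Tendsto (fun k : ℕ => ((k : ℝ) - 1) ^ ((j : ℝ) / ((j : ℝ) - 1))) atTop atTop :=
    (tendsto_rpow_atTop (div_pos (by linarith) hj1)).comp hR
  have hr : Tendsto (fun k : ℕ => ((k : ℝ) - 1) ^ (-(1 / ((j : ℝ) - 1)))) atTop
      (nhdsWithin 0 (Set.Ioi 0)) := by
    refine tendsto_nhdsWithin_iff.2
      ⟨(tendsto_rpow_neg_atTop (one_div_pos.2 hj1)).comp hR, ?_⟩
    filter_upwards [hR.eventually_gt_atTop 0] with k hk using Real.rpow_pos_of_pos hk _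
  have hlim := ((((((hP.const_div_atTop α).const_sub 1).mul
    (((tendsto_one_sub_exp_neg_mul_div (abar * y)).comp hr).pow (j - 1))).neg.rexp).const_sub
      1).pow (j - 1)).const_mul (α / abar)
  rw [sub_zero, one_mul] at hlim
  filter_upwards [eventually_ge_atTop 2, hP.eventually_ge_atTop α,
    hlim.eventually (lt_mem_nhds hlt)] with k hk hαP hk'
  exact ⟨hk, hαP, hk'.trans_le (le_gkLM1 hj hk habar hα hαP hy hyα)⟩

/-- Theorem 3 (converse direction) for LM1 on the q-SC: with
`ᾱ_j = sup {α > 0 : (1 - exp (-α^(j-1) x^(j-1)))^(j-1) ≤ x on (0,1]}` and `α > ᾱ_j`,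
there is a `K₂` such that for all integers `k ≥ K₂` (with `k - 1 > max(α,ᾱ_j)^(j-1)`),
the scaled LM1 density-evolution recursion `y₀ = 1`, `y_{i+1} = g_k (y_i)` does not
converge to `0`. -/
theorem stmt_8 (j : ℕ) (hj : 2 ≤ j) (abar : ℝ)
    (habar : abar = sSup {α : ℝ | 0 < α ∧ ∀ x ∈ Set.Ioc (0 : ℝ) 1,
      (1 - Real.exp (-(α ^ (j - 1) * x ^ (j - 1)))) ^ (j - 1) ≤ x})
    (α : ℝ) (hαgt : abar < α) :
    ∃ K₂ : ℕ, ∀ k : ℕ, K₂ ≤ k → (max α abar) ^ (j - 1) < (k : ℝ) - 1 →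
      ¬ Tendsto (fun i : ℕ => (fun y : ℝ => gkLM1 j abar α k y)^[i] 1) atTop (nhds 0) := by
  have hone : 1 ≤ abar :=
    habar ▸ le_csSup (bddAbove_admissibleLM1 hj) (one_mem_admissibleLM1 hj)
  have habar0 : 0 < abar := by linarith
  have hα0 : 0 < α := by linarith
  have hB : 1 ≤ α / abar := (one_le_div habar0).2 hαgt.le
  obtain ⟨y, hy, hlt⟩ := exists_lt_limit_map hj habar hαgt
  have hyB : y ≤ α / abar := hy.2.trans hB
  obtain ⟨K, hK⟩ := eventually_atTop.1
    (eventually_lt_gkLM1 hj habar0 hα0 hy.1.le hyB hlt)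
  refine ⟨K, fun k hk _ hlim => ?_⟩
  obtain ⟨-, hαP, hyk⟩ := hK k hk
  have hP := hα0.trans_le hαP
  have hmem : ∀ i : ℕ, (fun y : ℝ => gkLM1 j abar α k y)^[i] 1 ∈ Set.Icc y (α / abar) := by
    intro i
    induction i with
    | zero => exact ⟨hy.2, hB⟩
    | succ i ih =>
      rw [Function.iterate_succ_apply']
      exact ⟨hyk.le.trans (gkLM1_mono hj habar0 hα0 hP hαP hy.1.le ih.1 ih.2),
        gkLM1_le hj habar0 hα0 hP hαP (hy.1.le.trans ih.1) ih.2⟩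
  exact hy.1.not_ge (ge_of_tendsto' hlim fun i => (hmem i).1)
end

section
/- Define ᾱ_j as the supremum of the set of α > 0 such that (1 − exp(−α^{j−1}·x^{j−1}))^{j−1} ≤ x for all x ∈ (0,1]. Then: (a) ᾱ_2 = 1; and (b) for every integer j ≥ 3, with h_j(x) = (−ln(1 − x^{1/(j−1)})·x^{1−j})^{1/(j−1)} for x ∈ (0,1), one has ᾱ_j = inf_{x ∈ (0,1)} h_j(x), and this infimum is attained at a point x* ∈ (0,1) satisfying x*^{1/(j−1)} / ((1 − x*^{1/(j−1)})·ln(1 − x*^{1/(j−1)})) = −(j−1)². -/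
/-- The LM1 α-threshold `ᾱ_j`: the supremum of all `α > 0` such that
`(1 - exp (-α^(j-1)·x^(j-1)))^(j-1) ≤ x` for all `x ∈ (0,1]`. -/
noncomputable def abarLM1 (j : ℕ) : ℝ :=
  sSup {α : ℝ | 0 < α ∧ ∀ x ∈ Set.Ioc (0 : ℝ) 1,
    (1 - Real.exp (-(α ^ (j - 1) * x ^ (j - 1)))) ^ (j - 1) ≤ x}

/-- The auxiliary function `h_j(x) = (-ln(1 - x^{1/(j-1)})·x^{1-j})^{1/(j-1)}`. -/
noncomputable def hfun (j : ℕ) (x : ℝ) : ℝ :=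
  (-Real.log (1 - x ^ ((1 : ℝ) / ((j : ℝ) - 1))) * x ^ ((1 : ℝ) - (j : ℝ)))
    ^ ((1 : ℝ) / ((j : ℝ) - 1))

open Set

/-- The rational-exponent-free form of `hfun`, in the variable `y = x^{1/(j-1)}`. -/
noncomputable def negLogDivPow (N : ℕ) (y : ℝ) : ℝ := -Real.log (1 - y) / y ^ N

lemma hasDerivAt_negLogDivPow (N : ℕ) {y : ℝ} (hy : y ∈ Ioo (0 : ℝ) 1) :
    HasDerivAt (negLogDivPow N)
      ((1 / (1 - y) * y ^ N - -Real.log (1 - y) * (N * y ^ (N - 1))) / (y ^ N) ^ 2) y := by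
  have h1 : (1 - y) ≠ 0 := by linarith [hy.2]
  have h2 : y ^ N ≠ 0 := pow_ne_zero _ hy.1.ne'
  refine HasDerivAt.congr_deriv ((((hasDerivAt_id y).const_sub 1).log h1).neg.div (hasDerivAt_pow N y) h2) ?_
  simp only [id_eq, Pi.neg_apply, neg_div, neg_neg]

lemma le_neg_log_one_sub {y : ℝ} (hy : y < 1) : y ≤ -Real.log (1 - y) := by
  linarith [Real.log_le_sub_one_of_pos (sub_pos.2 hy)]

lemma inv_le_negLogDivPow {N : ℕ} (hN : 2 ≤ N) {y : ℝ} (hy : y ∈ Ioo (0 : ℝ) 1) :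
    y⁻¹ ≤ negLogDivPow N y := by
  have hpow : y ^ N ≤ y ^ 2 := pow_le_pow_of_le_one hy.1.le hy.2.le hN
  rw [negLogDivPow, le_div_iff₀ (pow_pos hy.1 N)]
  calc y⁻¹ * y ^ N ≤ y⁻¹ * y ^ 2 := by
        gcongr
        exact inv_nonneg.2 hy.1.le
    _ = y := by field_simp [hy.1.ne']
    _ ≤ _ := le_neg_log_one_sub hy.2

lemma neg_log_le_negLogDivPow (N : ℕ) {y : ℝ} (hy : y ∈ Ioo (0 : ℝ) 1) :
    -Real.log (1 - y) ≤ negLogDivPow N y := by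
  rw [negLogDivPow, le_div_iff₀ (pow_pos hy.1 N)]
  exact mul_le_of_le_one_right (hy.1.le.trans (le_neg_log_one_sub hy.2))
    (pow_le_one₀ hy.1.le hy.2.le)

lemma exists_isMinOn_negLogDivPow {N : ℕ} (hN : 2 ≤ N) :
    ∃ y ∈ Ioo (0 : ℝ) 1, IsMinOn (negLogDivPow N) (Ioo 0 1) y := by
  set C := negLogDivPow N (1 / 2)
  have hhalf : (1 / 2 : ℝ) ∈ Ioo (0 : ℝ) 1 := by norm_num
  have hC : 2 ≤ C := by
    have := inv_le_negLogDivPow hN hhalf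
    rwa [one_div, inv_inv, ← one_div] at this
  have hC' : -Real.log (1 - 1 / 2) ≤ C := neg_log_le_negLogDivPow N hhalf
  have ha : C⁻¹ ≤ 1 / 2 := by
    rw [one_div]
    exact inv_anti₀ two_pos hC
  have hb : 1 / 2 ≤ 1 - Real.exp (-C) := by
    have : Real.exp (-C) ≤ 1 - 1 / 2 := by
      rw [← Real.le_log_iff_exp_le (by norm_num)]
      linarith
    linarith
  have hsub : Icc C⁻¹ (1 - Real.exp (-C)) ⊆ Ioo 0 1 := fun y hy ↦
    ⟨(inv_pos.2 (by linarith)).trans_le hy.1, by linarith [hy.2, Real.exp_pos (-C)]⟩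
  obtain ⟨y, hy, hmin⟩ := isCompact_Icc.exists_isMinOn ⟨1 / 2, ha, hb⟩
    (f := negLogDivPow N) fun z hz ↦
      (hasDerivAt_negLogDivPow N (hsub hz)).continuousAt.continuousWithinAt
  have hyC : negLogDivPow N y ≤ C := hmin ⟨ha, hb⟩
  refine ⟨y, hsub hy, fun z hz ↦ ?_⟩
  by_cases h1 : z < C⁻¹
  · refine (hyC.trans ?_).trans (inv_le_negLogDivPow hN hz)
    exact ((lt_inv_comm₀ hz.1 (by linarith)).1 h1).le
  by_cases h2 : 1 - Real.exp (-C) < z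
  · refine (hyC.trans ?_).trans (neg_log_le_negLogDivPow N hz)
    have : Real.log (1 - z) ≤ -C :=
      (Real.log_le_iff_le_exp (by linarith [hz.2])).2 (by linarith)
    linarith
  · exact hmin ⟨not_lt.1 h1, not_lt.1 h2⟩

lemma IsMinOn.negLogDivPow_critical {N : ℕ} (hN : N ≠ 0) {y : ℝ} (hy : y ∈ Ioo (0 : ℝ) 1)
    (hmin : IsMinOn (negLogDivPow N) (Ioo 0 1) y) :
    y / ((1 - y) * Real.log (1 - y)) = -N := by
  have h0 := (hmin.isLocalMin (Ioo_mem_nhds hy.1 hy.2)).hasDerivAt_eq_zero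
    (hasDerivAt_negLogDivPow N hy)
  have hy0 := hy.1.ne'
  have h1 : 1 - y ≠ 0 := by linarith [hy.2]
  have hlog : Real.log (1 - y) ≠ 0 := by
    have := le_neg_log_one_sub hy.2
    have := hy.1
    linarith
  obtain ⟨n, rfl⟩ := Nat.exists_eq_succ_of_ne_zero hN
  rw [div_eq_zero_iff, or_iff_left (by positivity)] at h0
  have h2 : y ^ n * (y + (1 - y) * Real.log (1 - y) * (n + 1)) = 0 := by
    field_simp at h0
    simp only [Nat.succ_eq_add_one, Nat.add_sub_cancel, Nat.cast_add, Nat.cast_one] at h0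
    linear_combination h0
  have h3 := (mul_eq_zero.1 h2).resolve_left (pow_ne_zero _ hy0)
  rw [div_eq_iff (mul_ne_zero h1 hlog)]
  push_cast
  linear_combination h3

lemma hfun_pow {m : ℕ} (hm : m ≠ 0) {y : ℝ} (hy : y ∈ Ioo (0 : ℝ) 1) :
    hfun (m + 1) (y ^ m) = negLogDivPow (m ^ 2) y ^ ((1 : ℝ) / m) := by
  have hroot : (y ^ m) ^ ((1 : ℝ) / m) = y := by
    rw [one_div, Real.pow_rpow_inv_natCast hy.1.le hm]
  have hneg : (y ^ m) ^ (-(m : ℝ)) = (y ^ m ^ 2)⁻¹ := by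
    rw [Real.rpow_neg (pow_nonneg hy.1.le m), Real.rpow_natCast, ← pow_mul, sq]
  have hexp : (1 : ℝ) - ((m : ℝ) + 1) = -m := by ring
  simp only [hfun, negLogDivPow, Nat.cast_add, Nat.cast_one, add_sub_cancel_right, hexp, hroot,
    hneg]
  rw [div_eq_mul_inv (-Real.log (1 - y))]

lemma one_sub_exp_pow_le_iff {m : ℕ} (hm : m ≠ 0) {α y : ℝ} (hα : 0 < α)
    (hy : y ∈ Ioo (0 : ℝ) 1) :
    (1 - Real.exp (-(α ^ m * (y ^ m) ^ m))) ^ m ≤ y ^ m ↔ α ≤ hfun (m + 1) (y ^ m) := by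
  have hy0 := hy.1
  have hbase : 0 ≤ 1 - Real.exp (-(α ^ m * (y ^ m) ^ m)) := by
    rw [sub_nonneg, Real.exp_le_one_iff, neg_nonpos]
    positivity
  have hG : 0 ≤ negLogDivPow (m ^ 2) y :=
    (hy.1.le.trans (le_neg_log_one_sub hy.2)).trans (neg_log_le_negLogDivPow _ hy)
  rw [pow_le_pow_iff_left₀ hbase hy.1.le hm, hfun_pow hm hy, one_div,
    Real.le_rpow_inv_iff_of_pos hα.le hG (by positivity), Real.rpow_natCast, negLogDivPow,
    le_div_iff₀ (by positivity), sub_le_comm, ← Real.log_le_iff_le_exp (by linarith [hy.2]),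
    ← pow_mul, ← sq, le_neg]

lemma exists_pow_eq {m : ℕ} (hm : m ≠ 0) {x : ℝ} (hx : x ∈ Ioo (0 : ℝ) 1) :
    ∃ y ∈ Ioo (0 : ℝ) 1, y ^ m = x :=
  ⟨x ^ ((m : ℝ)⁻¹), ⟨Real.rpow_pos_of_pos hx.1 _,
    Real.rpow_lt_one hx.1.le hx.2 (by positivity)⟩, Real.rpow_inv_natCast_pow hx.1.le hm⟩

lemma abarLM1_eq_hfun_of_isMinOn {m : ℕ} (hm : m ≠ 0) {x : ℝ} (hx : x ∈ Ioo (0 : ℝ) 1)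
    (hmin : IsMinOn (hfun (m + 1)) (Ioo 0 1) x) : abarLM1 (m + 1) = hfun (m + 1) x := by
  have hpos : 0 < hfun (m + 1) x := by
    obtain ⟨y, hy, rfl⟩ := exists_pow_eq hm hx
    rw [hfun_pow hm hy]
    exact Real.rpow_pos_of_pos ((hy.1.trans_le (le_neg_log_one_sub hy.2)).trans_le
      (neg_log_le_negLogDivPow _ hy)) _
  have hset : {α : ℝ | 0 < α ∧ ∀ z ∈ Ioc (0 : ℝ) 1,
      (1 - Real.exp (-(α ^ m * z ^ m))) ^ m ≤ z} = Ioc 0 (hfun (m + 1) x) := by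
    ext α
    refine and_congr_right fun hα ↦ ⟨fun h ↦ ?_, fun h z hz ↦ ?_⟩
    · obtain ⟨y, hy, rfl⟩ := exists_pow_eq hm hx
      exact (one_sub_exp_pow_le_iff hm hα hy).1 (h _ (Ioo_subset_Ioc_self hx))
    · rcases hz.2.eq_or_lt with rfl | hz1
      · refine pow_le_one₀ ?_ (by linarith [Real.exp_pos (-(α ^ m * 1 ^ m))])
        rw [sub_nonneg, Real.exp_le_one_iff, neg_nonpos]
        positivity
      · have hz' : z ∈ Ioo (0 : ℝ) 1 := ⟨hz.1, hz1⟩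
        obtain ⟨y, hy, rfl⟩ := exists_pow_eq hm hz'
        exact (one_sub_exp_pow_le_iff hm hα hy).2 (h.trans (hmin hz'))
  rw [abarLM1, Nat.add_sub_cancel, hset, csSup_Ioc hpos]

lemma abarLM1_two : abarLM1 2 = 1 := by
  have hset : {α : ℝ | 0 < α ∧ ∀ x ∈ Ioc (0 : ℝ) 1,
      (1 - Real.exp (-(α ^ (2 - 1) * x ^ (2 - 1)))) ^ (2 - 1) ≤ x} = Ioc 0 1 := by
    ext α
    simp only [Nat.add_one_sub_one, pow_one]
    refine and_congr_right fun hα ↦ ⟨fun h ↦ ?_, fun h x hx ↦ ?_⟩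
    · by_contra! h1
      set x := (α - 1) / (2 * α)
      have hαx : α * x = (α - 1) / 2 := by
        simp only [x]
        field_simp
      have hx0 : 0 < x := div_pos (by linarith) (by linarith)
      have hx1 : x < 1 := (div_lt_one (by linarith)).2 (by linarith)
      have hle := h x ⟨hx0, hx1.le⟩
      have hinv : Real.exp (-(α * x)) * Real.exp (α * x) = 1 := by
        rw [← Real.exp_add, neg_add_cancel, Real.exp_zero]
      have hexp := Real.add_one_le_exp (α * x)
      have : (1 - x) * (α * x + 1) ≤ 1 := by
        refine le_trans ?_ hinv.le
        exact mul_le_mul (by linarith) hexp (by positivity) (Real.exp_pos _).le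
      nlinarith
    · have := Real.add_one_le_exp (-(α * x))
      have := mul_le_of_le_one_left hx.1.le h
      linarith
  rw [abarLM1, hset, csSup_Ioc one_pos]

/-- Computation of the LM1 α-thresholds: (a) `ᾱ_2 = 1`; (b) for `j ≥ 3`,
`ᾱ_j = inf_{x ∈ (0,1)} h_j(x)`, attained at an interior point `x*` satisfying
`x*^{1/(j-1)} / ((1 - x*^{1/(j-1)})·ln(1 - x*^{1/(j-1)})) = -(j-1)²`. -/
theorem stmt_9 :
    abarLM1 2 = 1 ∧
    ∀ j : ℕ, 3 ≤ j →
      abarLM1 j = sInf (hfun j '' Set.Ioo 0 1) ∧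
      ∃ xstar ∈ Set.Ioo (0 : ℝ) 1, hfun j xstar = abarLM1 j ∧
        xstar ^ ((1 : ℝ) / ((j : ℝ) - 1)) /
          ((1 - xstar ^ ((1 : ℝ) / ((j : ℝ) - 1))) *
            Real.log (1 - xstar ^ ((1 : ℝ) / ((j : ℝ) - 1)))) = -((j : ℝ) - 1) ^ 2 := by
  refine ⟨abarLM1_two, fun j hj ↦ ?_⟩
  obtain ⟨m, rfl⟩ : ∃ m, j = m + 1 := ⟨j - 1, by omega⟩
  have hm : m ≠ 0 := by omega
  have hN : 2 ≤ m ^ 2 := by nlinarith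
  obtain ⟨y, hy, hmin⟩ := exists_isMinOn_negLogDivPow hN
  have hx : y ^ m ∈ Ioo (0 : ℝ) 1 := ⟨pow_pos hy.1 m, pow_lt_one₀ hy.1.le hy.2 hm⟩
  have hminx : IsMinOn (hfun (m + 1)) (Ioo 0 1) (y ^ m) := by
    intro x hx
    obtain ⟨z, hz, rfl⟩ := exists_pow_eq hm hx
    rw [mem_ofPred_eq, hfun_pow hm hy, hfun_pow hm hz]
    exact Real.rpow_le_rpow ((hy.1.le.trans (le_neg_log_one_sub hy.2)).trans
      (neg_log_le_negLogDivPow _ hy)) (hmin hz) (by positivity)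
  have habar := abarLM1_eq_hfun_of_isMinOn hm hx hminx
  have hleast : IsLeast (hfun (m + 1) '' Ioo 0 1) (hfun (m + 1) (y ^ m)) :=
    ⟨mem_image_of_mem _ hx, forall_mem_image.2 fun _ hz ↦ hminx hz⟩
  refine ⟨habar.trans hleast.csInf_eq.symm, y ^ m, hx, habar.symm, ?_⟩
  have hcrit := hmin.negLogDivPow_critical (by positivity) hy
  have hroot : (y ^ m) ^ ((1 : ℝ) / m) = y := by
    rw [one_div, Real.pow_rpow_inv_natCast hy.1.le hm]
  rw [Nat.cast_add, Nat.cast_one, add_sub_cancel_right, hroot, hcrit, Nat.cast_pow]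
end

section
/- Let j ≥ 3 be an integer, let ᾱ > 0 and α > 0 be real numbers, and let k be an integer with k > α·j. With s(x) = 1 − (1 − αjx/k)^{k−1}, define g_k(x) = (α/ᾱ)·( s(x)^{j−1} + (j−1)·s(x)^{j−2}·(1 − αjx/k)^{k−1}·(1 − (1 − ((1 − αj/k)/(1 − αjx/k))·s(x)^{j−1})^{k−1}) ) and ḡ_k(x) = (α/ᾱ)·( (1 − (1 − αjx/k)^k)^{j−1} + (j−1)·(1 − (1 − αjx/k)^k)^{j−2}·(1 − αjx/k)^k ). Then for all x ∈ (0,1], g_k(x) < ḡ_k(x). -/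
/-- `s(x) = 1 - (1 - αjx/k)^(k-1)`, i.e. `1 - ρ(1-y)` for the (j,k)-regular ensemble. -/
noncomputable def sfun (j : ℕ) (α : ℝ) (k : ℕ) (x : ℝ) : ℝ :=
  1 - (1 - α * (j : ℝ) * x / (k : ℝ)) ^ (k - 1)

/-- The scaled density-evolution map `g_k` for LM2-MB verification decoding of
(j,k)-regular LDPC codes on the q-ary symmetric channel (via `δ = αj/k`,
`x_i = (ᾱj/k)·y_i`). -/
noncomputable def gLM2 (j : ℕ) (abar α : ℝ) (k : ℕ) (x : ℝ) : ℝ :=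
  α / abar *
    ((sfun j α k x) ^ (j - 1) +
      ((j : ℝ) - 1) * (sfun j α k x) ^ (j - 2) * (1 - α * (j : ℝ) * x / (k : ℝ)) ^ (k - 1) *
        (1 - (1 - ((1 - α * (j : ℝ) / (k : ℝ)) / (1 - α * (j : ℝ) * x / (k : ℝ))) *
          (sfun j α k x) ^ (j - 1)) ^ (k - 1)))

/-- The upper bound `ḡ_k` on the scaled LM2-MB density-evolution map. -/
noncomputable def gbarLM2 (j : ℕ) (abar α : ℝ) (k : ℕ) (x : ℝ) : ℝ :=
  α / abar *
    ((1 - (1 - α * (j : ℝ) * x / (k : ℝ)) ^ k) ^ (j - 1) +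
      ((j : ℝ) - 1) * (1 - (1 - α * (j : ℝ) * x / (k : ℝ)) ^ k) ^ (j - 2) *
        (1 - α * (j : ℝ) * x / (k : ℝ)) ^ k)

/-- The probability of at most one failure among `m + 2` trials with success probability `s`
is strictly increasing in `s`. -/
lemma strictMonoOn_pow_add_mul_pow_mul_one_sub (m : ℕ) :
    StrictMonoOn (fun s : ℝ => s ^ (m + 2) + ((m : ℝ) + 2) * s ^ (m + 1) * (1 - s))
      (Set.Icc 0 1) := by
  refine strictMonoOn_of_deriv_pos (convex_Icc 0 1) (by fun_prop) fun s hs => ?_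
  rw [interior_Icc] at hs
  have hderiv : HasDerivAt
      (fun s : ℝ => s ^ (m + 2) + ((m : ℝ) + 2) * s ^ (m + 1) * (1 - s))
      (((m : ℝ) + 1) * (m + 2) * s ^ m * (1 - s)) s := by
    refine HasDerivAt.congr_deriv ((hasDerivAt_pow (m + 2) s).add
      (((hasDerivAt_pow (m + 1) s).const_mul ((m : ℝ) + 2)).mul
        ((hasDerivAt_id s).const_sub 1))) ?_
    simp only [Nat.add_sub_cancel, show m + 2 - 1 = m + 1 by omega]
    push_cast
    ring
  rw [hderiv.deriv]
  have h0 := hs.1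
  have h1 : 0 < 1 - s := sub_pos.2 hs.2
  positivity

/-- Lemma 5(i) for LM2-MB: for `j ≥ 3`, `ᾱ > 0`, `α > 0`, an integer `k > αj`, and
`x ∈ (0,1]`, one has `g_k(x) < ḡ_k(x)`. -/
theorem stmt_11 (j : ℕ) (hj : 3 ≤ j) (abar α : ℝ) (habar : 0 < abar) (hα : 0 < α)
    (k : ℕ) (hk : α * (j : ℝ) < (k : ℝ)) (x : ℝ) (hx : x ∈ Set.Ioc (0 : ℝ) 1) :
    gLM2 j abar α k x < gbarLM2 j abar α k x := by
  obtain ⟨hx0, hx1⟩ := hx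
  obtain ⟨m, rfl⟩ : ∃ m, j = m + 3 := ⟨j - 3, by omega⟩
  have hαj : 0 < α * ((m + 3 : ℕ) : ℝ) := by positivity
  have hkpos : (0 : ℝ) < k := hαj.trans hk
  obtain ⟨n, rfl⟩ : ∃ n, k = n + 1 := Nat.exists_eq_succ_of_ne_zero (by rintro rfl; simp at hkpos)
  have hd1 : α * ((m + 3 : ℕ) : ℝ) / ((n + 1 : ℕ) : ℝ) < 1 := (div_lt_one hkpos).2 hk
  have hd0 : 0 < α * ((m + 3 : ℕ) : ℝ) / ((n + 1 : ℕ) : ℝ) := div_pos hαj hkpos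
  have hxd : α * ((m + 3 : ℕ) : ℝ) * x / ((n + 1 : ℕ) : ℝ)
      = α * ((m + 3 : ℕ) : ℝ) / ((n + 1 : ℕ) : ℝ) * x := by ring
  unfold gLM2 gbarLM2 sfun
  rw [hxd]
  generalize α * ((m + 3 : ℕ) : ℝ) / ((n + 1 : ℕ) : ℝ) = d at hd0 hd1
  have hdu : 1 - d ≤ 1 - d * x := by nlinarith
  have hu0 : 0 < 1 - d * x := by linarith
  have hu1 : 1 - d * x < 1 := by linarith [mul_pos hd0 hx0]
  generalize 1 - d * x = u at hdu hu0 hu1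
  simp only [Nat.add_sub_cancel, show m + 3 - 1 = m + 2 by omega, show m + 3 - 2 = m + 1 by omega]
  rw [show ((m + 3 : ℕ) : ℝ) - 1 = (m : ℝ) + 2 by push_cast; ring]
  refine mul_lt_mul_of_pos_left ?_ (div_pos hα habar)
  have hun0 : 0 < u ^ n := pow_pos hu0 n
  have hun1 : u ^ n ≤ 1 := pow_le_one₀ hu0.le hu1.le
  have hlt : u ^ (n + 1) < u ^ n := pow_lt_pow_right_of_lt_one₀ hu0 hu1 n.lt_succ_self
  have hsucc0 : 0 < u ^ (n + 1) := pow_pos hu0 _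
  have hs0 : 0 ≤ 1 - u ^ n := by linarith
  have hmono := strictMonoOn_pow_add_mul_pow_mul_one_sub m
    (a := 1 - u ^ n) ⟨hs0, by linarith⟩ (b := 1 - u ^ (n + 1)) ⟨by linarith, by linarith⟩
    (by linarith)
  simp only [sub_sub_cancel] at hmono
  refine lt_of_le_of_lt ?_ hmono
  have hr : (1 - d) / u * (1 - u ^ n) ^ (m + 2) ≤ 1 :=
    mul_le_one₀ ((div_le_one hu0).2 hdu) (by positivity) (pow_le_one₀ hs0 (by linarith))
  have hT : 0 ≤ (1 - (1 - d) / u * (1 - u ^ n) ^ (m + 2)) ^ n := pow_nonneg (by linarith) n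
  refine add_le_add le_rfl (mul_le_of_le_one_right (by positivity) (by linarith))
end

section
/- Let j ≥ 3 be an integer, let ᾱ > 0 and α > 0 be real numbers, and for integers k > α·j define, with s(x) = 1 − (1 − αjx/k)^{k−1}, the functions g_k(x) = (α/ᾱ)·( s(x)^{j−1} + (j−1)·s(x)^{j−2}·(1 − αjx/k)^{k−1}·(1 − (1 − ((1 − αj/k)/(1 − αjx/k))·s(x)^{j−1})^{k−1}) ) and ḡ_k(x) = (α/ᾱ)·( (1 − (1 − αjx/k)^k)^{j−1} + (j−1)·(1 − (1 − αjx/k)^k)^{j−2}·(1 − αjx/k)^k ). Then for each fixed x ∈ (0,1]: (a) lim_{k→∞} g_k(x) = lim_{k→∞} ḡ_k(x) = g_*(x), where g_*(x) = (α/ᾱ)·(1 − exp(−αjx))^{j−2}·(1 + (j−2)·exp(−αjx)); and (b) the sequence k ↦ ḡ_k(x) is monotonically decreasing in k. -/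
open Filter

/-- `(1 - c/k)^k` converges to `exp (-c)`. -/
theorem tendsto_one_sub_div_pow_exp (c : ℝ) :
    Tendsto (fun k : ℕ => (1 - c / (k : ℝ)) ^ k) atTop (nhds (Real.exp (-c))) := by
  have h := Real.tendsto_one_add_div_pow_exp (-c)
  refine h.congr fun k => ?_
  rw [neg_div, ← sub_eq_add_neg]

theorem tendsto_one_sub_div (c : ℝ) :
    Tendsto (fun k : ℕ => 1 - c / (k : ℝ)) atTop (nhds 1) := by
  simpa using (tendsto_const_div_atTop_nhds_zero_nat c).const_sub 1

/-- `(1 - c/k)^(k-1)` converges to `exp (-c)`. -/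
theorem tendsto_one_sub_div_pow_pred_exp (c : ℝ) :
    Tendsto (fun k : ℕ => (1 - c / (k : ℝ)) ^ (k - 1)) atTop (nhds (Real.exp (-c))) := by
  have h := (tendsto_one_sub_div_pow_exp c).div (tendsto_one_sub_div c) one_ne_zero
  rw [div_one] at h
  refine h.congr' ?_
  filter_upwards [(tendsto_one_sub_div c).eventually_ne one_ne_zero, eventually_ge_atTop 1]
    with k hk hk1
  simp only [Pi.div_apply]
  rw [div_eq_iff hk, ← pow_succ, Nat.sub_add_cancel hk1]

/-- Powers with growing exponent tend to zero if the base converges inside the unit disc. -/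
theorem tendsto_pow_pred_zero {u : ℕ → ℝ} {a : ℝ} (hu : Tendsto u atTop (nhds a))
    (ha : |a| < 1) : Tendsto (fun k : ℕ => u k ^ (k - 1)) atTop (nhds 0) := by
  obtain ⟨r, har, hr⟩ := exists_between ha
  have hr0 : 0 ≤ r := (abs_nonneg a).trans har.le
  have hpow : Tendsto (fun k : ℕ => r ^ (k - 1)) atTop (nhds 0) :=
    (tendsto_pow_atTop_nhds_zero_of_lt_one hr0 hr).comp (tendsto_sub_atTop_nat 1)
  refine squeeze_zero_norm' ?_ hpow
  filter_upwards [hu.abs.eventually_lt_const har] with k hk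
  rw [norm_pow]
  exact pow_le_pow_left₀ (norm_nonneg _) hk.le _

/-- `k ↦ (1 - c/k)^k` is increasing once `c ≤ k`. -/
theorem one_sub_div_pow_le_one_sub_div_pow {c : ℝ} (hc : 0 < c) {k l : ℕ} (hck : c ≤ k)
    (hkl : k ≤ l) : (1 - c / (k : ℝ)) ^ k ≤ (1 - c / (l : ℝ)) ^ l := by
  have hk : (0 : ℝ) < k := hc.trans_le hck
  have hkl' : (k : ℝ) ≤ l := by exact_mod_cast hkl
  have hl : (0 : ℝ) < l := hk.trans_le hkl'
  have hdk : c / (k : ℝ) ≤ 1 := (div_le_one hk).2 hck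
  have hdl : c / (l : ℝ) ≤ 1 := (div_le_one hl).2 (hck.trans hkl')
  have hbern := one_add_mul_self_le_rpow_one_add (s := -(c / (l : ℝ))) (by linarith)
    (p := (l : ℝ) / k) ((one_le_div hk).2 hkl')
  have hlin : 1 + (l : ℝ) / k * -(c / (l : ℝ)) = 1 - c / k := by
    field_simp
    ring
  rw [hlin, ← sub_eq_add_neg] at hbern
  calc (1 - c / (k : ℝ)) ^ k ≤ ((1 - c / (l : ℝ)) ^ ((l : ℝ) / k)) ^ k :=
        pow_le_pow_left₀ (by linarith) hbern k
    _ = (1 - c / (l : ℝ)) ^ l := by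
        rw [← Real.rpow_mul_natCast (by linarith), div_mul_cancel₀ _ hk.ne', Real.rpow_natCast]

/-- The probability of at least `m` successes in `m + 1` Bernoulli trials increases with the
success probability. -/
theorem monotoneOn_pow_succ_add_mul_pow (m : ℕ) :
    MonotoneOn (fun w : ℝ => w ^ (m + 1) + ((m : ℝ) + 1) * w ^ m * (1 - w)) (Set.Icc 0 1) := by
  have hderiv (w : ℝ) :
      HasDerivAt (fun w : ℝ => w ^ (m + 1) + ((m : ℝ) + 1) * w ^ m * (1 - w))
        (((m : ℝ) + 1) * (m * w ^ (m - 1)) * (1 - w)) w := by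
    have h := (hasDerivAt_pow (m + 1) w).add
      (((hasDerivAt_pow m w).const_mul ((m : ℝ) + 1)).mul ((hasDerivAt_id w).const_sub 1))
    refine h.congr_deriv ?_
    simp only [Nat.add_sub_cancel, id]
    push_cast
    ring
  refine monotoneOn_of_deriv_nonneg (convex_Icc 0 1)
    (fun w _ => (hderiv w).continuousAt.continuousWithinAt)
    (fun w _ => (hderiv w).differentiableAt.differentiableWithinAt) fun w hw => ?_
  rw [interior_Icc] at hw
  rw [(hderiv w).deriv]
  have h0 := hw.1.le
  have h1 : 0 ≤ 1 - w := sub_nonneg.2 hw.2.le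
  positivity

/-- Lemma 5(ii),(iii) for LM2-MB: for fixed `x ∈ (0,1]`,
(a) both `g_k(x)` and `ḡ_k(x)` converge, as `k → ∞`, to
`g_*(x) = (α/ᾱ)·(1 - exp (-αjx))^(j-2)·(1 + (j-2)·exp (-αjx))`, and
(b) `k ↦ ḡ_k(x)` is monotonically decreasing in `k` (for `k > αj`). -/
theorem stmt_12 (j : ℕ) (hj : 3 ≤ j) (abar α : ℝ) (habar : 0 < abar) (hα : 0 < α)
    (x : ℝ) (hx : x ∈ Set.Ioc (0 : ℝ) 1) :
    Tendsto (fun k : ℕ => gLM2 j abar α k x) atTop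
      (nhds (α / abar * (1 - Real.exp (-(α * (j : ℝ) * x))) ^ (j - 2) *
        (1 + ((j : ℝ) - 2) * Real.exp (-(α * (j : ℝ) * x))))) ∧
    Tendsto (fun k : ℕ => gbarLM2 j abar α k x) atTop
      (nhds (α / abar * (1 - Real.exp (-(α * (j : ℝ) * x))) ^ (j - 2) *
        (1 + ((j : ℝ) - 2) * Real.exp (-(α * (j : ℝ) * x))))) ∧
    (∀ k l : ℕ, α * (j : ℝ) < (k : ℝ) → k ≤ l →
      gbarLM2 j abar α l x ≤ gbarLM2 j abar α k x) := by
  obtain ⟨hx0, hx1⟩ := hx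
  obtain ⟨n, rfl⟩ := Nat.exists_eq_add_of_le' hj
  rw [show n + 3 - 2 = n + 1 by omega]
  set b : ℝ := α * ((n + 3 : ℕ) : ℝ) with hb
  have hb0 : 0 < b := by positivity
  set c : ℝ := b * x with hc
  have hc0 : 0 < c := by positivity
  set e : ℝ := Real.exp (-c) with he
  have he0 : 0 < e := Real.exp_pos _
  have he1 : e < 1 := Real.exp_lt_one_iff.2 (by linarith)
  have hlimit : α / abar * (1 - e) ^ (n + 1) * (1 + (((n + 3 : ℕ) : ℝ) - 2) * e) =
      α / abar * ((1 - e) ^ (n + 2) + (((n + 3 : ℕ) : ℝ) - 1) * (1 - e) ^ (n + 1) * e) := by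
    ring
  rw [hlimit]
  refine ⟨?_, ?_, fun k l hk hkl => ?_⟩
  · have hp := tendsto_one_sub_div_pow_pred_exp c
    have hs : Tendsto (fun k : ℕ => sfun (n + 3) α k x) atTop (nhds (1 - e)) := hp.const_sub 1
    have hratio := (tendsto_one_sub_div b).div (tendsto_one_sub_div c) one_ne_zero
    have hbase := (hratio.mul (hs.pow (n + 2))).const_sub 1
    have hpos : 0 < (1 - e) ^ (n + 2) := pow_pos (by linarith) _
    have hle : (1 - e) ^ (n + 2) ≤ 1 := pow_le_one₀ (by linarith) (by linarith)
    have hvanish := tendsto_pow_pred_zero hbase (by rw [abs_lt]; constructor <;> linarith)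
    have h := ((hs.pow (n + 2)).add ((((hs.pow (n + 1)).const_mul
      (((n + 3 : ℕ) : ℝ) - 1)).mul hp).mul (hvanish.const_sub 1))).const_mul (α / abar)
    rw [sub_zero, mul_one] at h
    exact h
  · have hz := tendsto_one_sub_div_pow_exp c
    have hw := hz.const_sub 1
    exact ((hw.pow (n + 2)).add (((hw.pow (n + 1)).const_mul
      (((n + 3 : ℕ) : ℝ) - 1)).mul hz)).const_mul (α / abar)
  · have hcb : c ≤ b := mul_le_of_le_one_right hb0.le hx1
    have hunit {i : ℕ} (hi : k ≤ i) :
        1 - (1 - c / (i : ℝ)) ^ i ∈ Set.Icc (0 : ℝ) 1 := by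
      have hki : (k : ℝ) ≤ i := by exact_mod_cast hi
      have hdiv : c / (i : ℝ) ≤ 1 := (div_le_one (by linarith)).2 (by linarith)
      have hdiv0 : 0 ≤ c / (i : ℝ) := by positivity
      have h0 : 0 ≤ (1 - c / (i : ℝ)) ^ i := pow_nonneg (by linarith) i
      have h1 : (1 - c / (i : ℝ)) ^ i ≤ 1 := pow_le_one₀ (by linarith) (by linarith)
      constructor <;> linarith
    have hz := one_sub_div_pow_le_one_sub_div_pow hc0 (k := k) (by linarith) hkl
    have h := monotoneOn_pow_succ_add_mul_pow (n + 1) (hunit hkl) (hunit le_rfl)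
      (sub_le_sub_left hz 1)
    have hgbar (i : ℕ) : gbarLM2 (n + 3) abar α i x = α / abar *
        ((1 - (1 - c / (i : ℝ)) ^ i) ^ (n + 1 + 1) + (((n + 1 : ℕ) : ℝ) + 1) *
          (1 - (1 - c / (i : ℝ)) ^ i) ^ (n + 1) * (1 - (1 - (1 - c / (i : ℝ)) ^ i))) := by
      rw [gbarLM2, show n + 3 - 2 = n + 1 by omega, show n + 3 - 1 = n + 1 + 1 by omega,
        sub_sub_cancel, show ((n + 1 : ℕ) : ℝ) + 1 = ((n + 3 : ℕ) : ℝ) - 1 by push_cast; ring]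
    rw [hgbar, hgbar]
    exact mul_le_mul_of_nonneg_left h (by positivity)
end

section
/- Let j ≥ 3 be an integer and define ᾱ_j as the supremum of the set of α > 0 such that (1 − exp(−αjx))^{j−2}·(1 + (j−2)·exp(−αjx)) ≤ x for all x ∈ (0,1]. Let α be a real number with 0 < α < ᾱ_j, and for each integer k > αj define the scaled LM2-MB density-evolution map g_k as follows: with s(x) = 1 − (1 − αjx/k)^{k−1}, g_k(x) = (α/ᾱ_j)·( s(x)^{j−1} + (j−1)·s(x)^{j−2}·(1 − αjx/k)^{k−1}·(1 − (1 − ((1 − αj/k)/(1 − αjx/k))·s(x)^{j−1})^{k−1}) ). Then there exists K₁ < ∞ such that for every integer k ≥ K₁, the sequence defined by y_0 = 1 and y_{i+1} = g_k(y_i) converges to 0 as i → ∞. -/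
open Filter

theorem monotoneOn_succ_mul_pow_sub (m : ℕ) :
    MonotoneOn (fun s : ℝ => ((m : ℝ) + 1) * s ^ m - m * s ^ (m + 1)) (Set.Icc 0 1) := by
  have hd : ∀ s : ℝ, HasDerivAt (fun s : ℝ => ((m : ℝ) + 1) * s ^ m - m * s ^ (m + 1))
      (((m : ℝ) + 1) * m * s ^ (m - 1) - (m : ℝ) * (m + 1) * s ^ m) s := by
    intro s
    have h := ((hasDerivAt_pow m s).const_mul ((m : ℝ) + 1)).sub
      ((hasDerivAt_pow (m + 1) s).const_mul (m : ℝ))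
    refine h.congr_deriv ?_
    push_cast
    ring
  refine monotoneOn_of_deriv_nonneg (convex_Icc 0 1)
    (fun s _ => (hd s).continuousAt.continuousWithinAt)
    (fun s _ => (hd s).differentiableAt.differentiableWithinAt) fun s hs => ?_
  rw [interior_Icc] at hs
  rw [(hd s).deriv]
  have hpow : s ^ m ≤ s ^ (m - 1) :=
    pow_le_pow_of_le_one hs.1.le hs.2.le (Nat.sub_le m 1)
  have hm : (0 : ℝ) ≤ ((m : ℝ) + 1) * m := by positivity
  nlinarith [mul_le_mul_of_nonneg_left hpow hm]

/-- The map `t ↦ (1 - t)^m (1 + m t)` is antitone on `[0, 1]`. -/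
theorem one_sub_pow_mul_le (m : ℕ) {a b : ℝ} (ha : 0 ≤ a) (hab : a ≤ b) (hb : b ≤ 1) :
    (1 - b) ^ m * (1 + m * b) ≤ (1 - a) ^ m * (1 + m * a) := by
  have h := monotoneOn_succ_mul_pow_sub m (a := 1 - b) (b := 1 - a)
    ⟨by linarith, by linarith⟩ ⟨by linarith, by linarith⟩ (by linarith)
  simp only [pow_succ] at h
  linarith

theorem exp_neg_div_one_sub_le {z : ℝ} (hz : z < 1) : Real.exp (-(z / (1 - z))) ≤ 1 - z := by
  have h1 : 0 < 1 - z := by linarith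
  have h2 : (1 - z)⁻¹ ≤ Real.exp (z / (1 - z)) := by
    have h := Real.add_one_le_exp (z / (1 - z))
    have h3 : z / (1 - z) + 1 = (1 - z)⁻¹ := by field_simp; ring
    linarith
  rw [Real.exp_neg]
  exact inv_le_of_inv_le₀ h1 h2

/-- If `c` is slightly smaller than `b`, then `(1 - cx/k)^(k-1)` dominates `exp (-bx)` uniformly
on `[0, 1]`. -/
theorem exp_neg_mul_le_one_sub_div_pow {b c x : ℝ} {k : ℕ} (hc : 0 ≤ c) (hck : c < k)
    (hcb : c ≤ b * (1 - c / k)) (hx0 : 0 ≤ x) (hx1 : x ≤ 1) :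
    Real.exp (-(b * x)) ≤ (1 - c * x / k) ^ (k - 1) := by
  have hk : (0 : ℝ) < k := hc.trans_lt hck
  have hk1 : 1 ≤ k := by exact_mod_cast hk
  have hle : c * x / k ≤ c / k :=
    div_le_div_of_nonneg_right (mul_le_of_le_one_right hc hx1) (Nat.cast_nonneg k)
  have hlt : c / k < 1 := (div_lt_one hk).2 hck
  have hz : c * x / k < 1 := hle.trans_lt hlt
  have hz0 : 0 ≤ c * x / k := by positivity
  have hpos : 0 < 1 - c * x / k := by linarith
  have hb : 0 ≤ b := by
    by_contra! hb
    nlinarith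
  refine le_trans ?_ (pow_le_pow_left₀ (Real.exp_pos _).le (exp_neg_div_one_sub_le hz) (k - 1))
  rw [← Real.exp_nat_mul, Real.exp_le_exp, mul_neg, neg_le_neg_iff, Nat.cast_sub hk1,
    Nat.cast_one, ← mul_div_assoc, div_le_iff₀ hpos]
  have h1 : ((k : ℝ) - 1) * (c * x / k) ≤ c * x := by
    have h2 : (k : ℝ) * (c * x / k) = c * x := by field_simp
    linarith
  have h3 : c * x ≤ b * (1 - c / k) * x := mul_le_mul_of_nonneg_right hcb hx0
  have h4 : b * x * (1 - c / k) ≤ b * x * (1 - c * x / k) := by gcongr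
  linarith

theorem gLM2_zero {j : ℕ} (hj : 3 ≤ j) (abar α : ℝ) (k : ℕ) : gLM2 j abar α k 0 = 0 := by
  have h1 : j - 1 ≠ 0 := by omega
  have h2 : j - 2 ≠ 0 := by omega
  simp [gLM2, sfun, h1, h2]

/-- The map `g_k` is nonnegative on `[0, 1]` and bounded by the map obtained on replacing the
last factor by `1`. -/
theorem gLM2_nonneg_and_le {j : ℕ} (hj : 3 ≤ j) {abar α : ℝ} (hα : 0 < α) (habar : 0 < abar)
    {k : ℕ} (hk : α * j < k) {x : ℝ} (hx0 : 0 ≤ x) (hx1 : x ≤ 1) :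
    0 ≤ gLM2 j abar α k x ∧
      gLM2 j abar α k x ≤ α / abar * ((1 - (1 - α * j * x / k) ^ (k - 1)) ^ (j - 2) *
        (1 + ((j : ℝ) - 2) * (1 - α * j * x / k) ^ (k - 1))) := by
  have hj' : (3 : ℝ) ≤ j := by exact_mod_cast hj
  have hc : 0 ≤ α * j := by positivity
  have hk0 : (0 : ℝ) < k := hc.trans_lt hk
  have hle : α * j * x / k ≤ α * j / k :=
    div_le_div_of_nonneg_right (mul_le_of_le_one_right hc hx1) (Nat.cast_nonneg k)
  have hlt : α * j / k < 1 := (div_lt_one hk0).2 hk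
  have hz0 : 0 ≤ α * j * x / k := by positivity
  have hu0 : 0 < 1 - α * j * x / k := by linarith
  have hr0 : 0 ≤ (1 - α * j / k) / (1 - α * j * x / k) := div_nonneg (by linarith) hu0.le
  have hr1 : (1 - α * j / k) / (1 - α * j * x / k) ≤ 1 := (div_le_one hu0).2 (by linarith)
  have ht0 : 0 ≤ (1 - α * j * x / k) ^ (k - 1) := pow_nonneg hu0.le _
  have ht1 : (1 - α * j * x / k) ^ (k - 1) ≤ 1 := pow_le_one₀ hu0.le (by linarith)
  have hj1 : j - 1 = j - 2 + 1 := by omega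
  unfold gLM2 sfun
  set t := (1 - α * j * x / k) ^ (k - 1)
  set r := (1 - α * j / k) / (1 - α * j * x / k)
  have hs0 : 0 ≤ 1 - t := by linarith
  have hp0 : 0 ≤ r * (1 - t) ^ (j - 1) := mul_nonneg hr0 (pow_nonneg hs0 _)
  have hp1 : r * (1 - t) ^ (j - 1) ≤ 1 :=
    mul_le_one₀ hr1 (pow_nonneg hs0 _) (pow_le_one₀ hs0 (by linarith))
  have hw0 : 0 ≤ (1 - r * (1 - t) ^ (j - 1)) ^ (k - 1) := pow_nonneg (by linarith) _
  have hw1 : (1 - r * (1 - t) ^ (j - 1)) ^ (k - 1) ≤ 1 := pow_le_one₀ (by linarith) (by linarith)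
  set w := (1 - r * (1 - t) ^ (j - 1)) ^ (k - 1)
  have hq : 0 ≤ ((j : ℝ) - 1) * (1 - t) ^ (j - 2) * t :=
    mul_nonneg (mul_nonneg (by linarith) (pow_nonneg hs0 _)) ht0
  have hratio : 0 ≤ α / abar := by positivity
  refine ⟨mul_nonneg hratio (add_nonneg (pow_nonneg hs0 _) (mul_nonneg hq (by linarith))), ?_⟩
  refine mul_le_mul_of_nonneg_left ?_ hratio
  have h1 : ((j : ℝ) - 1) * (1 - t) ^ (j - 2) * t * (1 - w) ≤
      ((j : ℝ) - 1) * (1 - t) ^ (j - 2) * t := mul_le_of_le_one_right hq (by linarith)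
  rw [hj1, pow_succ]
  linarith

theorem tendsto_iterate_zero_of_le_mul_s13 {f : ℝ → ℝ} {c : ℝ} (hc0 : 0 ≤ c) (hc1 : c < 1)
    (hf : ∀ x, 0 ≤ x → x ≤ 1 → 0 ≤ f x ∧ f x ≤ c * x) :
    Tendsto (fun i : ℕ => f^[i] 1) atTop (nhds 0) := by
  have hb : ∀ i : ℕ, 0 ≤ f^[i] 1 ∧ f^[i] 1 ≤ c ^ i := by
    intro i
    induction i with
    | zero => simp
    | succ i ih =>
      rw [Function.iterate_succ_apply']
      obtain ⟨h0, h1⟩ := hf _ ih.1 (ih.2.trans (pow_le_one₀ hc0 hc1.le))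
      refine ⟨h0, h1.trans ?_⟩
      rw [pow_succ']
      exact mul_le_mul_of_nonneg_left ih.2 hc0
  exact squeeze_zero (fun i => (hb i).1) (fun i => (hb i).2)
    (tendsto_pow_atTop_nhds_zero_of_lt_one hc0 hc1)

/-- Theorem 5 (success direction) for LM2-MB on the q-SC: with
`ᾱ_j = sup {α > 0 : (1 - exp (-αjx))^(j-2)·(1 + (j-2)·exp (-αjx)) ≤ x on (0,1]}` and
`0 < α < ᾱ_j`, there is a `K₁` such that for all integers `k ≥ K₁` (with `k > αj`), the
scaled LM2-MB density-evolution recursion `y₀ = 1`, `y_{i+1} = g_k (y_i)` converges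
to `0`. -/
theorem stmt_13 (j : ℕ) (hj : 3 ≤ j) (abar : ℝ)
    (habar : abar = sSup {α : ℝ | 0 < α ∧ ∀ x ∈ Set.Ioc (0 : ℝ) 1,
      (1 - Real.exp (-(α * (j : ℝ) * x))) ^ (j - 2) *
        (1 + ((j : ℝ) - 2) * Real.exp (-(α * (j : ℝ) * x))) ≤ x})
    (α : ℝ) (hα : 0 < α) (hαlt : α < abar) :
    ∃ K₁ : ℕ, ∀ k : ℕ, K₁ ≤ k → α * (j : ℝ) < (k : ℝ) →
      Tendsto (fun i : ℕ => (fun y : ℝ => gLM2 j abar α k y)^[i] 1) atTop (nhds 0) := by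
  have habar0 : 0 < abar := hα.trans hαlt
  obtain ⟨β, ⟨hβ, hβle⟩, hαβ⟩ : ∃ β ∈ {α : ℝ | 0 < α ∧ ∀ x ∈ Set.Ioc (0 : ℝ) 1,
      (1 - Real.exp (-(α * (j : ℝ) * x))) ^ (j - 2) *
        (1 + ((j : ℝ) - 2) * Real.exp (-(α * (j : ℝ) * x))) ≤ x}, α < β := by
    refine exists_lt_of_lt_csSup (Set.nonempty_iff_ne_empty.2 fun hempty => ?_) (habar ▸ hαlt)
    rw [hempty, Real.sSup_empty] at habar
    exact habar0.ne' habar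
  have hj0 : (0 : ℝ) < j := by exact_mod_cast (by omega : 0 < j)
  have hlim : Tendsto (fun k : ℕ => β * j * (1 - α * j / (k : ℝ))) atTop (nhds (β * j)) := by
    simpa using ((tendsto_const_div_atTop_nhds_zero_nat (α * j)).const_sub 1).const_mul (β * j)
  obtain ⟨K, hK⟩ := eventually_atTop.1
    (hlim.eventually_const_le (mul_lt_mul_of_pos_right hαβ hj0))
  refine ⟨K, fun k hkK hk => tendsto_iterate_zero_of_le_mul_s13 (by positivity)
    ((div_lt_one habar0).2 hαlt) fun x hx0 hx1 => ?_⟩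
  obtain ⟨hg0, hg1⟩ := gLM2_nonneg_and_le hj hα habar0 hk hx0 hx1
  refine ⟨hg0, ?_⟩
  rcases hx0.eq_or_lt with rfl | hxpos
  · simp [gLM2_zero hj]
  refine hg1.trans (mul_le_mul_of_nonneg_left ?_ (by positivity))
  have hcast : ((j - 2 : ℕ) : ℝ) = (j : ℝ) - 2 := by
    rw [Nat.cast_sub (by omega)]
    norm_num
  have hk0 : (0 : ℝ) < k := (by positivity : 0 < α * (j : ℝ)).trans hk
  have hu0 : 0 ≤ 1 - α * j * x / k := by
    rw [sub_nonneg, div_le_one hk0]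
    exact (mul_le_of_le_one_right (by positivity) hx1).trans hk.le
  have hu1 : 1 - α * j * x / k ≤ 1 := sub_le_self 1 (by positivity)
  have hle := one_sub_pow_mul_le (j - 2) (Real.exp_pos _).le
    (exp_neg_mul_le_one_sub_div_pow (by positivity) hk (hK k hkK) hx0 hx1)
    (pow_le_one₀ hu0 hu1)
  rw [hcast] at hle
  exact hle.trans (hβle x ⟨hxpos, hx1⟩)
end

section
/- Let j ≥ 3 be an integer and define ᾱ_j as the supremum of the set of α > 0 such that (1 − exp(−αjx))^{j−2}·(1 + (j−2)·exp(−αjx)) ≤ x for all x ∈ (0,1]. Let α > ᾱ_j, and for each integer k > αj define the scaled LM2-MB density-evolution map g_k as follows: with s(x) = 1 − (1 − αjx/k)^{k−1}, g_k(x) = (α/ᾱ_j)·( s(x)^{j−1} + (j−1)·s(x)^{j−2}·(1 − αjx/k)^{k−1}·(1 − (1 − ((1 − αj/k)/(1 − αjx/k))·s(x)^{j−1})^{k−1}) ). Then there exists K₂ < ∞ such that for every integer k ≥ K₂, the sequence defined by y_0 = 1 and y_{i+1} = g_k(y_i) does not converge to 0. -/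
open Filter

lemma monotoneOn_pow_mul_one_add (m : ℕ) :
    MonotoneOn (fun s : ℝ => s ^ m * (1 + m * (1 - s))) (Set.Icc 0 1) := by
  have hd : ∀ s : ℝ, HasDerivAt (fun s : ℝ => s ^ m * (1 + m * (1 - s)))
      (m * s ^ (m - 1) * (1 + m * (1 - s)) + s ^ m * (m * (-1))) s := fun s =>
    (hasDerivAt_pow m s).mul ((((hasDerivAt_id s).const_sub 1).const_mul (m : ℝ)).const_add 1)
  refine monotoneOn_of_deriv_nonneg (convex_Icc 0 1)
    (fun s _ => (hd s).continuousAt.continuousWithinAt)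
    (fun s _ => (hd s).differentiableAt.differentiableWithinAt) fun s hs => ?_
  rw [interior_Icc] at hs
  rw [(hd s).deriv]
  rcases m with _ | m
  · simp
  have h0 : 0 ≤ 1 - s := by linarith [hs.2]
  have h1 : 0 ≤ s := hs.1.le
  have : ((m + 1 : ℕ) : ℝ) * s ^ (m + 1 - 1) * (1 + (m + 1 : ℕ) * (1 - s)) +
      s ^ (m + 1) * ((m + 1 : ℕ) * (-1)) = (m + 1) * (m + 2) * s ^ m * (1 - s) := by
    push_cast
    ring
  rw [this]
  positivity

lemma tendsto_one_sub_div_pow_pred (b : ℝ) :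
    Tendsto (fun k : ℕ => (1 - b / (k : ℝ)) ^ (k - 1)) atTop (nhds (Real.exp (-b))) := by
  have h1 := Real.tendsto_one_add_div_pow_exp (-b)
  have h2 : Tendsto (fun k : ℕ => 1 - b / (k : ℝ)) atTop (nhds 1) := by
    simpa using (tendsto_const_div_atTop_nhds_zero_nat b).const_sub 1
  have h3 := h1.div h2 one_ne_zero
  rw [div_one] at h3
  refine h3.congr' ?_
  filter_upwards [h2.eventually_ne one_ne_zero, eventually_ge_atTop 1] with k hk hk1
  obtain ⟨n, rfl⟩ := Nat.exists_eq_add_of_le' hk1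
  simp only [Pi.div_apply, Nat.add_sub_cancel, neg_div, ← sub_eq_add_neg]
  rw [pow_succ, mul_div_cancel_right₀ _ hk]

/-- The threshold set for the limiting map is bounded above. -/
lemma bddAbove_threshold {j : ℕ} (hj : 3 ≤ j) :
    BddAbove {α : ℝ | 0 < α ∧ ∀ x ∈ Set.Ioc (0 : ℝ) 1,
      (1 - Real.exp (-(α * (j : ℝ) * x))) ^ (j - 2) *
        (1 + ((j : ℝ) - 2) * Real.exp (-(α * (j : ℝ) * x))) ≤ x} := by
  have hj' : (3 : ℝ) ≤ j := by exact_mod_cast hj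
  have hE : Tendsto (fun α : ℝ => Real.exp (-(α * (j : ℝ) * (1 / 2)))) atTop (nhds 0) := by
    refine Real.tendsto_exp_neg_atTop_nhds_zero.comp ?_
    exact (tendsto_id.atTop_mul_const (by linarith)).atTop_mul_const (by norm_num)
  have hF : Tendsto (fun α : ℝ => (1 - Real.exp (-(α * (j : ℝ) * (1 / 2)))) ^ (j - 2) *
        (1 + ((j : ℝ) - 2) * Real.exp (-(α * (j : ℝ) * (1 / 2))))) atTop (nhds 1) := by
    simpa using ((hE.const_sub 1).pow (j - 2)).mul ((hE.const_mul ((j : ℝ) - 2)).const_add 1)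
  obtain ⟨A, hA⟩ := eventually_atTop.1 (hF.eventually_const_lt (show (1 / 2 : ℝ) < 1 by norm_num))
  refine ⟨A, fun α hα => ?_⟩
  by_contra! h
  exact absurd (hα.2 (1 / 2) ⟨by norm_num, by norm_num⟩) (not_le.2 (hA α h.le))

/-- The threshold set for the limiting map contains a positive number. -/
lemma exists_mem_threshold {j : ℕ} (hj : 3 ≤ j) :
    ∃ α : ℝ, 0 < α ∧ ∀ x ∈ Set.Ioc (0 : ℝ) 1,
      (1 - Real.exp (-(α * (j : ℝ) * x))) ^ (j - 2) *
        (1 + ((j : ℝ) - 2) * Real.exp (-(α * (j : ℝ) * x))) ≤ x := by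
  have hj' : (3 : ℝ) ≤ j := by exact_mod_cast hj
  refine ⟨1 / ((j : ℝ) * j), by positivity, fun x hx => ?_⟩
  have hb : 1 / ((j : ℝ) * j) * j * x = x / j := by field_simp
  rw [hb]
  have hx0 : 0 ≤ x / j := div_nonneg hx.1.le (by linarith)
  have h1 : Real.exp (-(x / j)) ≤ 1 := Real.exp_le_one_iff.2 (by linarith)
  have h2 : 1 - x / j ≤ Real.exp (-(x / j)) := Real.one_sub_le_exp_neg _
  have hpos := Real.exp_pos (-(x / j))
  have h3 : (1 - Real.exp (-(x / j))) ^ (j - 2) ≤ 1 - Real.exp (-(x / j)) :=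
    pow_le_of_le_one (by linarith) (by linarith) (by omega)
  calc (1 - Real.exp (-(x / j))) ^ (j - 2) * (1 + ((j : ℝ) - 2) * Real.exp (-(x / j)))
      ≤ (x / j) * j := by
        refine mul_le_mul (by linarith) ?_ ?_ hx0
        · nlinarith
        · nlinarith
    _ = x := div_mul_cancel₀ x (by linarith)

/-- Bounds on the bracket of the density-evolution map when the term `w` is at most `η`. -/
lemma bracket_mem_Icc (m : ℕ) {s w η : ℝ} (hs0 : 0 ≤ s) (hs1 : s ≤ 1) (hw0 : 0 ≤ w)
    (hwη : w ≤ η) :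
    s ^ (m + 1) + (m + 1) * s ^ m * (1 - s) * (1 - w) ∈
      Set.Icc (s ^ m * (1 + m * (1 - s)) - (m + 1) * η) (m + 2) := by
  have hm0 : (0 : ℝ) ≤ m := m.cast_nonneg
  have hB : s ^ (m + 1) + (m + 1) * s ^ m * (1 - s) * (1 - w) =
      s ^ m * (1 + m * (1 - s)) - (m + 1) * (s ^ m * (1 - s) * w) := by ring
  have hsm0 : 0 ≤ s ^ m := pow_nonneg hs0 m
  have hsm : s ^ m ≤ 1 := pow_le_one₀ hs0 hs1
  have hp0 : 0 ≤ s ^ m * (1 - s) := mul_nonneg hsm0 (sub_nonneg.2 hs1)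
  have hp1 : s ^ m * (1 - s) ≤ 1 := mul_le_one₀ hsm (sub_nonneg.2 hs1) (by linarith)
  have hpw0 : 0 ≤ s ^ m * (1 - s) * w := mul_nonneg hp0 hw0
  have hpw1 : s ^ m * (1 - s) * w ≤ η := (mul_le_of_le_one_left hw0 hp1).trans hwη
  rw [hB]
  constructor
  · gcongr
  · have h1 := mul_le_mul_of_nonneg_left hp1 hm0
    have h2 := mul_nonneg (by linarith : (0 : ℝ) ≤ m + 1) hpw0
    linarith

/-- If the base point `x₀` satisfies the required estimates, `[x₀, M]` is invariant. -/
lemma mapsTo_gLM2_Icc (m k : ℕ) {abar α x₀ M c : ℝ} (habar0 : 0 < abar) (hα : abar ≤ α)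
    (hx0 : 0 < x₀) (hk0 : (0 : ℝ) < k) (hM : M = α / abar * (m + 2)) (hc0 : 0 < c) (hc1 : c ≤ 1)
    (h1 : α * ((m + 2 : ℕ) : ℝ) / k < 1 / 2) (h2 : α * ((m + 2 : ℕ) : ℝ) * M / k < 1)
    (h3 : 0 < (1 - α * ((m + 2 : ℕ) : ℝ) * M / k) - sfun (m + 2) α k M)
    (h4 : c < sfun (m + 2) α k x₀)
    (h5 : x₀ < sfun (m + 2) α k x₀ ^ m * (1 + m * (1 - sfun (m + 2) α k x₀)) -
      (m + 1) * (1 - c ^ (m + 1) / 2) ^ (k - 1)) :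
    Set.MapsTo (gLM2 (m + 2) abar α k) (Set.Icc x₀ M) (Set.Icc x₀ M) := by
  have hα0 : 0 < α := habar0.trans_le hα
  have hratio : 1 ≤ α / abar := (one_le_div habar0).2 hα
  have e1 : m + 2 - 1 = m + 1 := by omega
  have e2 : m + 2 - 2 = m := by omega
  have hb0 : 0 < α * ((m + 2 : ℕ) : ℝ) := by positivity
  set b : ℝ := α * ((m + 2 : ℕ) : ℝ) with hb
  have hcp : c ^ (m + 1) ≤ 1 := pow_le_one₀ hc0.le hc1
  have hsmono : ∀ x y : ℝ, x ≤ y → y ≤ M → sfun (m + 2) α k x ≤ sfun (m + 2) α k y := by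
    intro x y hxy hy
    refine sub_le_sub_left (pow_le_pow_left₀ ?_ ?_ _) 1
    · have : b * y / k ≤ b * M / k := by gcongr
      linarith
    · change 1 - b * y / k ≤ 1 - b * x / k
      gcongr
  rintro y ⟨hy0, hyM⟩
  have hsy := hsmono x₀ y hy0 hyM
  have hsM := hsmono y M hyM le_rfl
  have hyk : b * y / k ≤ b * M / k := by gcongr
  have hyk0 : 0 ≤ b * y / k := by
    have := hx0.trans_le hy0
    positivity
  have hdef : sfun (m + 2) α k y = 1 - (1 - b * y / k) ^ (k - 1) := rfl
  have hu0 : 0 ≤ (1 - b * y / k) ^ (k - 1) := pow_nonneg (by linarith) _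
  have ht : 0 < 1 - b * y / k := by linarith
  have hmon := monotoneOn_pow_mul_one_add m (a := sfun (m + 2) α k x₀) (b := sfun (m + 2) α k y)
    ⟨by linarith, by linarith⟩ ⟨by linarith, by linarith⟩ hsy
  simp only at hmon
  rw [gLM2, ← hb, e1, e2]
  have hu : (1 - b * y / k) ^ (k - 1) = 1 - sfun (m + 2) α k y := by rw [hdef]; ring
  rw [hu] at hu0 ⊢
  generalize sfun (m + 2) α k y = s at *
  have hs0 : 0 < s := by linarith
  have hs1 : s ≤ 1 := by linarith
  have hsp : s ^ (m + 1) ≤ s := pow_le_of_le_one hs0.le hs1 (by omega)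
  have hsc : c ^ (m + 1) ≤ s ^ (m + 1) := pow_le_pow_left₀ hc0.le (by linarith) _
  set r : ℝ := (1 - b / k) / (1 - b * y / k) with hr
  have hr1 : 1 / 2 ≤ r := by
    rw [hr, le_div_iff₀ ht]
    linarith
  have hrs : r * s ^ (m + 1) ≤ 1 := by
    rw [hr, div_mul_eq_mul_div, div_le_one ht]
    have : 0 < b / k := by positivity
    have : 0 < s ^ (m + 1) := by positivity
    nlinarith
  have hrs' : c ^ (m + 1) / 2 ≤ r * s ^ (m + 1) := by
    have := mul_le_mul_of_nonneg_right hr1 (pow_nonneg hs0.le (m + 1))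
    linarith
  have hw0 : 0 ≤ (1 - r * s ^ (m + 1)) ^ (k - 1) := pow_nonneg (by linarith) _
  have hw1 : (1 - r * s ^ (m + 1)) ^ (k - 1) ≤ (1 - c ^ (m + 1) / 2) ^ (k - 1) :=
    pow_le_pow_left₀ (by linarith) (by linarith) _
  generalize (1 - r * s ^ (m + 1)) ^ (k - 1) = w at *
  have hcast : ((m + 2 : ℕ) : ℝ) - 1 = m + 1 := by push_cast; ring
  rw [hcast]
  obtain ⟨hlo, hhi⟩ := bracket_mem_Icc m hs0.le hs1 hw0 hw1
  have hlo' : x₀ ≤ s ^ (m + 1) + (m + 1) * s ^ m * (1 - s) * (1 - w) := by linarith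
  rw [hM]
  exact ⟨hlo'.trans (le_mul_of_one_le_left (hx0.le.trans hlo') hratio),
    mul_le_mul_of_nonneg_left hhi (by linarith)⟩

/-- Theorem 5 (converse direction) for LM2-MB on the q-SC: with
`ᾱ_j = sup {α > 0 : (1 - exp (-αjx))^(j-2)·(1 + (j-2)·exp (-αjx)) ≤ x on (0,1]}` and
`α > ᾱ_j`, there is a `K₂` such that for all integers `k ≥ K₂` (with `k > αj`), the
scaled LM2-MB density-evolution recursion `y₀ = 1`, `y_{i+1} = g_k (y_i)` does not
converge to `0`. -/
theorem stmt_14 (j : ℕ) (hj : 3 ≤ j) (abar : ℝ)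
    (habar : abar = sSup {α : ℝ | 0 < α ∧ ∀ x ∈ Set.Ioc (0 : ℝ) 1,
      (1 - Real.exp (-(α * (j : ℝ) * x))) ^ (j - 2) *
        (1 + ((j : ℝ) - 2) * Real.exp (-(α * (j : ℝ) * x))) ≤ x})
    (α : ℝ) (hαgt : abar < α) :
    ∃ K₂ : ℕ, ∀ k : ℕ, K₂ ≤ k → α * (j : ℝ) < (k : ℝ) →
      ¬ Tendsto (fun i : ℕ => (fun y : ℝ => gLM2 j abar α k y)^[i] 1) atTop (nhds 0) := by
  obtain ⟨β, hβ0, hβ⟩ := exists_mem_threshold hj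
  have habar0 : 0 < abar := by
    rw [habar]
    exact hβ0.trans_le (le_csSup (bddAbove_threshold hj) ⟨hβ0, hβ⟩)
  have hα0 : 0 < α := habar0.trans hαgt
  obtain ⟨x₀, ⟨hx0, hx1⟩, hfx⟩ : ∃ x ∈ Set.Ioc (0 : ℝ) 1,
      x < (1 - Real.exp (-(α * (j : ℝ) * x))) ^ (j - 2) *
        (1 + ((j : ℝ) - 2) * Real.exp (-(α * (j : ℝ) * x))) := by
    by_contra! h
    refine absurd (le_csSup (bddAbove_threshold hj) ⟨hα0, h⟩) ?_
    rw [← habar]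
    exact not_le.2 hαgt
  have hratio : 1 ≤ α / abar := (one_le_div habar0).2 hαgt.le
  obtain ⟨m, rfl⟩ : ∃ m, j = m + 2 := ⟨j - 2, by omega⟩
  have e2 : m + 2 - 2 = m := by omega
  have hjm : ((m + 2 : ℕ) : ℝ) - 2 = m := by push_cast; ring
  set b : ℝ := α * ((m + 2 : ℕ) : ℝ) with hb
  have hb0 : 0 < b := by positivity
  rw [e2, hjm] at hfx
  set M : ℝ := α / abar * (m + 2) with hM
  have hm0 : (0 : ℝ) ≤ m := m.cast_nonneg
  have hM1 : 1 ≤ M := by nlinarith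
  have hs : ∀ x, Tendsto (fun k => sfun (m + 2) α k x) atTop (nhds (1 - Real.exp (-(b * x)))) :=
    fun x => (tendsto_one_sub_div_pow_pred (b * x)).const_sub 1
  have hsx : 0 < 1 - Real.exp (-(b * x₀)) := by
    rw [sub_pos, Real.exp_lt_one_iff]
    nlinarith
  set c : ℝ := (1 - Real.exp (-(b * x₀))) / 2 with hc
  have hc0 : 0 < c := by positivity
  have hc1 : c ≤ 1 := by linarith [Real.exp_pos (-(b * x₀))]
  have hcp : c ^ (m + 1) ≤ 1 := pow_le_one₀ hc0.le hc1
  have hcp0 : 0 < c ^ (m + 1) := by positivity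
  have hdiv : ∀ d : ℝ, Tendsto (fun k : ℕ => d / (k : ℝ)) atTop (nhds 0) :=
    tendsto_const_div_atTop_nhds_zero_nat
  have hw : Tendsto (fun k : ℕ => (1 - c ^ (m + 1) / 2) ^ (k - 1)) atTop (nhds 0) :=
    (tendsto_pow_atTop_nhds_zero_of_lt_one (by linarith) (by linarith)).comp
      (tendsto_sub_atTop_nat 1)
  have hlow : Tendsto (fun k : ℕ => sfun (m + 2) α k x₀ ^ m *
      (1 + m * (1 - sfun (m + 2) α k x₀)) - (m + 1) * (1 - c ^ (m + 1) / 2) ^ (k - 1)) atTop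
      (nhds ((1 - Real.exp (-(b * x₀))) ^ m * (1 + m * Real.exp (-(b * x₀))))) := by
    have := (((hs x₀).pow m).mul ((((hs x₀).const_sub 1).const_mul (m : ℝ)).const_add 1)).sub
      (hw.const_mul ((m : ℝ) + 1))
    simpa using this
  have hM' : Tendsto (fun k : ℕ => (1 - b * M / (k : ℝ)) - sfun (m + 2) α k M) atTop
      (nhds (Real.exp (-(b * M)))) := by
    have := ((hdiv (b * M)).const_sub 1).sub (hs M)
    simpa using this
  have hev : ∀ᶠ k : ℕ in atTop, b / (k : ℝ) < 1 / 2 ∧ b * M / (k : ℝ) < 1 ∧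
      0 < (1 - b * M / (k : ℝ)) - sfun (m + 2) α k M ∧ c < sfun (m + 2) α k x₀ ∧
      x₀ < sfun (m + 2) α k x₀ ^ m *
      (1 + m * (1 - sfun (m + 2) α k x₀)) - (m + 1) * (1 - c ^ (m + 1) / 2) ^ (k - 1) := by
    filter_upwards [(hdiv b).eventually_lt_const (by norm_num : (0 : ℝ) < 1 / 2),
      (hdiv (b * M)).eventually_lt_const one_pos,
      hM'.eventually_const_lt (Real.exp_pos _),
      (hs x₀).eventually_const_lt (by linarith : c < 1 - Real.exp (-(b * x₀))),
      hlow.eventually_const_lt hfx] with k h1 h2 h3 h4 h5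
    exact ⟨h1, h2, h3, h4, h5⟩
  obtain ⟨K, hK⟩ := eventually_atTop.1 hev
  refine ⟨K, fun k hk hbk hlim => ?_⟩
  obtain ⟨h1, h2, h3, h4, h5⟩ := hK k hk
  have hk0 : (0 : ℝ) < k := hb0.trans hbk
  have hiter : ∀ i : ℕ, (fun y : ℝ => gLM2 (m + 2) abar α k y)^[i] 1 ∈ Set.Icc x₀ M := by
    intro i
    induction i with
    | zero => exact ⟨hx1, hM1⟩
    | succ i ih =>
      rw [Function.iterate_succ_apply']
      exact mapsTo_gLM2_Icc m k habar0 hαgt.le hx0 hk0 hM hc0 hc1 h1 h2 h3 h4 h5 ih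
  exact absurd (ge_of_tendsto' hlim fun i => (hiter i).1) (not_le.2 hx0)
end

section
/- Let n, j, k, a, b be positive integers with j ≥ 1, k ≥ 2, k dividing nj, 1 ≤ a, 1 ≤ b, and a + b < n. Define the average LM1 stopping-set enumerator E_{n,j,k}(a,b) = [n!/(a!·b!·(n−a−b)!)] / [(nj)!/((aj)!·(bj)!·((n−a−b)j)!)] · S_{n,j,k}(a,b), where S_{n,j,k}(a,b) is the coefficient of x^{ja}·y^{jb} in the polynomial ((1+x+y)^k − ky − ((1+x)^k − 1))^{nj/k}. Then for all real x > 0 and y > 0, E_{n,j,k}(a,b) ≤ j·exp(1/(12jn))·exp((1−j)·n·H)·(1 + (1+x+y)^k − ky − (1+x)^k)^{nj/k}·x^{−ja}·y^{−jb}, where H = −(a/n)·ln(a/n) − (b/n)·ln(b/n) − (1 − (a+b)/n)·ln(1 − (a+b)/n). -/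
open MvPolynomial

/-- The ratio `D` of the two multinomial coefficients
`(n choose a, b, n-a-b) / (nj choose aj, bj, (n-a-b)j)`. -/
noncomputable def Dmult (n j a b : ℕ) : ℝ :=
  ((n.factorial : ℝ) / ((a.factorial : ℝ) * (b.factorial : ℝ) * ((n - a - b).factorial : ℝ))) /
    (((n * j).factorial : ℝ) /
      (((a * j).factorial : ℝ) * ((b * j).factorial : ℝ) * (((n - a - b) * j).factorial : ℝ)))

/-- The ternary entropy (in nats) of the distribution `(a/n, b/n, 1 - (a+b)/n)`. -/
noncomputable def Hent (n a b : ℕ) : ℝ :=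
  -((a : ℝ) / (n : ℝ)) * Real.log ((a : ℝ) / (n : ℝ)) -
    ((b : ℝ) / (n : ℝ)) * Real.log ((b : ℝ) / (n : ℝ)) -
    (1 - ((a : ℝ) + (b : ℝ)) / (n : ℝ)) * Real.log (1 - ((a : ℝ) + (b : ℝ)) / (n : ℝ))

/-- `S_{n,j,k}(a,b)`: the coefficient of `x^{ja}·y^{jb}` in the polynomial
`((1+x+y)^k - ky - ((1+x)^k - 1))^{nj/k}`, counting the LM1 stopping-set edge-connection
patterns of a (j,k)-regular code with `a` correct and `b` incorrect variable nodes. -/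
noncomputable def Snjk (n j k a b : ℕ) : ℝ :=
  MvPolynomial.coeff (Finsupp.single 0 (j * a) + Finsupp.single 1 (j * b))
    (((1 + X 0 + X 1) ^ k - (k : MvPolynomial (Fin 2) ℝ) * X 1 -
      ((1 + X 0) ^ k - 1)) ^ (n * j / k))

/-- Chernoff bound for a coefficient of a polynomial with nonnegative coefficients. -/
theorem coeff_mul_prod_le_eval {σ : Type*} [Fintype σ] (p : MvPolynomial σ ℝ)
    (hp : ∀ d, 0 ≤ p.coeff d) (v : σ → ℝ) (hv : ∀ i, 0 ≤ v i) (d : σ →₀ ℕ) :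
    p.coeff d * ∏ i, v i ^ d i ≤ eval v p := by
  have hnonneg : ∀ e : σ →₀ ℕ, 0 ≤ p.coeff e * ∏ i, v i ^ e i := fun e =>
    mul_nonneg (hp e) (Finset.prod_nonneg fun i _ => pow_nonneg (hv i) _)
  rw [eval_eq']
  by_cases hd : d ∈ p.support
  · exact Finset.single_le_sum (f := fun e => p.coeff e * ∏ i, v i ^ e i)
      (fun e _ => hnonneg e) hd
  · rw [notMem_support_iff.mp hd, zero_mul]
    exact Finset.sum_nonneg fun e _ => hnonneg e

theorem exists_one_add_pow_eq {R : Type*} [CommSemiring R] (s : R) (k : ℕ) :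
    ∃ r, (1 + s) ^ k = 1 + r := by
  induction k with
  | zero => exact ⟨0, by simp⟩
  | succ k ih =>
    obtain ⟨r, hr⟩ := ih
    exact ⟨r + s + r * s, by rw [pow_succ, hr]; ring⟩

/-- The subtractions in the check-node generating function can be carried out in any
commutative semiring. -/
theorem exists_one_add_add_pow_eq {R : Type*} [CommSemiring R] (s t : R) (k : ℕ) :
    ∃ q, (1 + s + t) ^ k = (1 + s) ^ k + k * t + q := by
  induction k with
  | zero => exact ⟨0, by simp⟩
  | succ k ih =>
    obtain ⟨q, hq⟩ := ih
    obtain ⟨r, hr⟩ := exists_one_add_pow_eq s k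
    refine ⟨t * r + k * s * t + k * t ^ 2 + (1 + s + t) * q, ?_⟩
    rw [pow_succ, hq, pow_succ, hr]
    push_cast
    ring

/-- The check-node generating function of LM1 stopping sets, raised to a power, has nonnegative
coefficients. -/
theorem coeff_checkNode_pow_nonneg (k N : ℕ) (d : Fin 2 →₀ ℕ) :
    0 ≤ coeff d (((1 + X 0 + X 1) ^ k - (k : MvPolynomial (Fin 2) ℝ) * X 1 -
      ((1 + X 0) ^ k - 1)) ^ N) := by
  obtain ⟨q, hq⟩ := exists_one_add_add_pow_eq (X 0 : MvPolynomial (Fin 2) ℕ) (X 1) k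
  have hmap := congrArg (map (Nat.castRingHom ℝ)) hq
  simp only [map_add, map_mul, map_pow, map_one, map_X, map_natCast] at hmap
  have hg : (1 + X 0 + X 1) ^ k - (k : MvPolynomial (Fin 2) ℝ) * X 1 - ((1 + X 0) ^ k - 1) =
      map (Nat.castRingHom ℝ) (1 + q) := by
    rw [hmap, map_add, map_one]
    ring
  rw [hg, ← map_pow, coeff_map]
  exact Nat.cast_nonneg _

theorem Snjk_le (n j k a b : ℕ) {x y : ℝ} (hx : 0 < x) (hy : 0 < y) :
    Snjk n j k a b ≤ (1 + (1 + x + y) ^ k - (k : ℝ) * y - (1 + x) ^ k) ^ (n * j / k) *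
      (x ^ (j * a))⁻¹ * (y ^ (j * b))⁻¹ := by
  have h := coeff_mul_prod_le_eval _ (coeff_checkNode_pow_nonneg k (n * j / k)) ![x, y]
    (by simp [Fin.forall_fin_two, hx.le, hy.le])
    (Finsupp.single 0 (j * a) + Finsupp.single 1 (j * b))
  have heval : eval ![x, y] (((1 + X 0 + X 1) ^ k - (k : MvPolynomial (Fin 2) ℝ) * X 1 -
      ((1 + X 0) ^ k - 1)) ^ (n * j / k)) =
      (1 + (1 + x + y) ^ k - (k : ℝ) * y - (1 + x) ^ k) ^ (n * j / k) := by
    simp only [map_pow, map_sub, map_add, map_mul, map_one, map_natCast, eval_X,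
      Matrix.cons_val_zero, Matrix.cons_val_one]
    congr 1
    ring
  have hprod : ∏ i, ![x, y] i ^
      (Finsupp.single 0 (j * a) + Finsupp.single 1 (j * b) : Fin 2 →₀ ℕ) i =
      x ^ (j * a) * y ^ (j * b) := by
    simp [Fin.prod_univ_two]
  rw [heval, hprod] at h
  rw [← div_eq_mul_inv, ← div_eq_mul_inv, div_div, le_div_iff₀ (by positivity)]
  exact h

section Stirling

open Stirling

theorem le_log_stirlingSeq_sdiff {m : ℕ} (hm : m ≠ 0) :
    1 / (24 * (m : ℝ) * (m + 1)) ≤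
      Real.log (stirlingSeq m) - Real.log (stirlingSeq (m + 1)) := by
  obtain ⟨l, rfl⟩ := Nat.exists_eq_succ_of_ne_zero hm
  have h := le_hasSum (log_stirlingSeq_sdiff_hasSum l) 0 fun i _ => by positivity
  refine le_trans ?_ h
  push_cast
  have hl : (0 : ℝ) ≤ l := l.cast_nonneg
  rw [pow_one, one_div_pow, one_div_mul_one_div]
  refine one_div_le_one_div_of_le (by positivity) ?_
  nlinarith

theorem log_stirlingSeq_sub_add_le (m i : ℕ) (hm : m ≠ 0) :
    Real.log (stirlingSeq m) - Real.log (stirlingSeq (m + i)) ≤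
      (1 / (m : ℝ) - 1 / ((m : ℝ) + i)) / 12 := by
  have hm' : (0 : ℝ) < m := by positivity
  induction i with
  | zero => simp
  | succ i ih =>
    have h := log_stirlingSeq_sdiff_le (m + i)
    have heq : 1 / (12 * ((m + i : ℕ) : ℝ) * ((m + i : ℕ) + 1)) =
        (1 / ((m : ℝ) + i) - 1 / ((m : ℝ) + (i + 1 : ℕ))) / 12 := by
      push_cast
      have : (m : ℝ) + (i + 1) ≠ 0 := by positivity
      field_simp
      ring
    rw [heq] at h
    rw [← add_assoc]
    linarith

/-- `log (stirlingSeq m / stirlingSeq (m * j))` decreases in `m`. -/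
theorem log_stirlingSeq_sub_mul_antitone {j : ℕ} (hj : 1 ≤ j) {m n : ℕ} (hm : m ≠ 0)
    (hmn : m ≤ n) :
    Real.log (stirlingSeq n) - Real.log (stirlingSeq (n * j)) ≤
      Real.log (stirlingSeq m) - Real.log (stirlingSeq (m * j)) := by
  rcases hj.eq_or_lt with rfl | hj2
  · simp
  induction n, hmn using Nat.le_induction with
  | base => rfl
  | succ n hmn ih =>
    have hn : n ≠ 0 := by omega
    have hn' : (0 : ℝ) < n := by positivity
    have hj' : (2 : ℝ) ≤ j := by exact_mod_cast hj2
    have h₁ := le_log_stirlingSeq_sdiff hn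
    have h₂ := log_stirlingSeq_sub_add_le (n * j) j (by positivity)
    have h₃ : (1 / ((n * j : ℕ) : ℝ) - 1 / (((n * j : ℕ) : ℝ) + j)) / 12 ≤
        1 / (24 * (n : ℝ) * (n + 1)) := by
      have heq : (1 / ((n * j : ℕ) : ℝ) - 1 / (((n * j : ℕ) : ℝ) + j)) / 12 =
          1 / (12 * j * n * (n + 1)) := by
        push_cast
        field_simp
        ring
      rw [heq]
      refine one_div_le_one_div_of_le (by positivity) ?_
      gcongr
      linarith
    rw [add_one_mul]
    linarith

theorem log_stirlingSeq_mul_le {j : ℕ} (hj : 1 ≤ j) {m : ℕ} (hm : m ≠ 0) :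
    Real.log (stirlingSeq (m * j)) ≤ Real.log (stirlingSeq m) := by
  obtain ⟨l, rfl⟩ := Nat.exists_eq_succ_of_ne_zero hm
  obtain ⟨i, hi⟩ := Nat.exists_eq_succ_of_ne_zero (n := l.succ * j) (by positivity)
  rw [hi]
  refine log_stirlingSeq'_antitone ?_
  have := Nat.le_mul_of_pos_right l.succ hj
  omega

theorem log_factorial_mul_sub {j : ℕ} (hj : 1 ≤ j) {m : ℕ} (hm : m ≠ 0) :
    Real.log ((m * j).factorial : ℝ) - Real.log (m.factorial : ℝ) =
      Real.log (stirlingSeq (m * j)) - Real.log (stirlingSeq m) + Real.log j / 2 +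
        m * ((j - 1) * (Real.log m - 1) + j * Real.log j) := by
  have hm' : (m : ℝ) ≠ 0 := by positivity
  have hj' : (j : ℝ) ≠ 0 := by positivity
  rw [log_stirlingSeq_formula, log_stirlingSeq_formula]
  push_cast
  rw [Real.log_div (by positivity) (by positivity), Real.log_div hm' (by positivity),
    Real.log_mul two_ne_zero (by positivity), Real.log_mul two_ne_zero hm',
    Real.log_mul hm' hj', Real.log_exp]
  ring

end Stirling

theorem mul_Hent {n a b c : ℕ} (ha : a ≠ 0) (hb : b ≠ 0) (hc : c ≠ 0) (hn : n = a + b + c) :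
    (n : ℝ) * Hent n a b =
      n * Real.log n - a * Real.log a - b * Real.log b - c * Real.log c := by
  have hn0 : (n : ℝ) ≠ 0 := by
    have : n ≠ 0 := by omega
    positivity
  have hc' : 1 - ((a : ℝ) + b) / n = c / n := by
    field_simp
    rw [hn]
    push_cast
    ring
  rw [Hent, hc', Real.log_div (by positivity) hn0, Real.log_div (by positivity) hn0,
    Real.log_div (by positivity) hn0]
  field_simp
  rw [hn]
  push_cast
  ring

theorem Dmult_pos (n j a b : ℕ) : 0 < Dmult n j a b := by
  unfold Dmult
  positivity

theorem Dmult_le {n j a b : ℕ} (hj : 1 ≤ j) (ha : 1 ≤ a) (hb : 1 ≤ b) (hab : a + b < n) :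
    Dmult n j a b ≤ j * Real.exp ((1 - (j : ℝ)) * n * Hent n a b) := by
  obtain ⟨c, hc⟩ : ∃ c, n - a - b = c := ⟨_, rfl⟩
  have hn : n = a + b + c := by omega
  have ha0 : a ≠ 0 := by omega
  have hb0 : b ≠ 0 := by omega
  have hc0 : c ≠ 0 := by omega
  have hn0 : n ≠ 0 := by omega
  have hj' : (0 : ℝ) < j := by positivity
  have hlog : Real.log (Dmult n j a b) =
      (Real.log ((a * j).factorial : ℝ) - Real.log (a.factorial : ℝ)) +
      (Real.log ((b * j).factorial : ℝ) - Real.log (b.factorial : ℝ)) +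
      (Real.log ((c * j).factorial : ℝ) - Real.log (c.factorial : ℝ)) -
      (Real.log ((n * j).factorial : ℝ) - Real.log (n.factorial : ℝ)) := by
    rw [Dmult, hc]
    simp (disch := positivity) only [Real.log_div, Real.log_mul]
    ring
  rw [← Real.log_le_log_iff (Dmult_pos n j a b) (by positivity),
    Real.log_mul hj'.ne' (Real.exp_ne_zero _), Real.log_exp, mul_assoc, mul_Hent ha0 hb0 hc0 hn,
    hlog, log_factorial_mul_sub hj ha0, log_factorial_mul_sub hj hb0,
    log_factorial_mul_sub hj hc0, log_factorial_mul_sub hj hn0]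
  have h₁ := log_stirlingSeq_sub_mul_antitone hj ha0 (show a ≤ n by omega)
  have h₂ := log_stirlingSeq_mul_le hj hb0
  have h₃ := log_stirlingSeq_mul_le hj hc0
  have hcast : (n : ℝ) = a + b + c := by exact_mod_cast hn
  have hcancel : (n : ℝ) * ((1 - j) + j * Real.log j) =
      (a + b + c) * ((1 - j) + j * Real.log j) := by rw [hcast]
  linarith

/-- Chernoff-type bound on the average LM1 stopping-set enumerator
`E_{n,j,k}(a,b) = Dmult·S_{n,j,k}(a,b)`: for all real `x, y > 0`,
`E ≤ j·exp (1/(12jn))·exp ((1-j)·n·H)·(1 + (1+x+y)^k - ky - (1+x)^k)^{nj/k}·x^{-ja}·y^{-jb}`. -/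
theorem stmt_17 (n j k a b : ℕ) (hn : 0 < n) (hj : 1 ≤ j) (hk : 2 ≤ k)
    (hdvd : k ∣ n * j) (ha : 1 ≤ a) (hb : 1 ≤ b) (hab : a + b < n)
    (x y : ℝ) (hx : 0 < x) (hy : 0 < y) :
    Dmult n j a b * Snjk n j k a b ≤
      (j : ℝ) * Real.exp (1 / (12 * (j : ℝ) * (n : ℝ))) *
        Real.exp ((1 - (j : ℝ)) * (n : ℝ) * Hent n a b) *
        (1 + (1 + x + y) ^ k - (k : ℝ) * y - (1 + x) ^ k) ^ (n * j / k) *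
        (x ^ (j * a))⁻¹ * (y ^ (j * b))⁻¹ := by
  have hS := Snjk_le n j k a b hx hy
  have hS0 : 0 ≤ (1 + (1 + x + y) ^ k - (k : ℝ) * y - (1 + x) ^ k) ^ (n * j / k) *
      (x ^ (j * a))⁻¹ * (y ^ (j * b))⁻¹ :=
    (coeff_checkNode_pow_nonneg k (n * j / k) _).trans hS
  have hexp : 1 ≤ Real.exp (1 / (12 * (j : ℝ) * (n : ℝ))) := Real.one_le_exp (by positivity)
  have hD : Dmult n j a b ≤ j * Real.exp (1 / (12 * (j : ℝ) * (n : ℝ))) *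
      Real.exp ((1 - (j : ℝ)) * n * Hent n a b) := by
    refine (Dmult_le hj ha hb hab).trans ?_
    gcongr
    exact le_mul_of_one_le_right (by positivity) hexp
  calc Dmult n j a b * Snjk n j k a b
      ≤ Dmult n j a b * ((1 + (1 + x + y) ^ k - (k : ℝ) * y - (1 + x) ^ k) ^ (n * j / k) *
          (x ^ (j * a))⁻¹ * (y ^ (j * b))⁻¹) :=
        mul_le_mul_of_nonneg_left hS (Dmult_pos n j a b).le
    _ ≤ _ := mul_le_mul_of_nonneg_right hD hS0
    _ = _ := by ring
end
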